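/- arXiv:2209.00212 — 6 statements merged into one kernel-verified Lean document; each statement's English description precedes it below -/
import Mathlib

section
/- For every real number p ≥ 6, the ratio of the p-th power integrals of the positive and negative parts of the 4n-th Legendre polynomial stays bounded away from 1 in the limit: liminf_{n→∞} (∫₀¹ P_{4n,+}(x)^p dx) / (∫₀¹ P_{4n,-}(x)^p dx) > 1. -/
open MeasureTheory Filter

/-- The `n`-th Legendre polynomial, via Rodrigues formula:
`P_n(x) = (1/(2^n n!)) (d/dx)^n (x^2 - 1)^n`. -/
noncomputable def legP (n : ℕ) : ℝ → ℝ := fun x =>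
  (1 / ((2 : ℝ) ^ n * (n.factorial : ℝ))) *
    iteratedDeriv n (fun y : ℝ => (y ^ 2 - 1) ^ n) x

/-- Positive part of the `n`-th Legendre polynomial. -/
noncomputable def legPpos (n : ℕ) (x : ℝ) : ℝ := max (legP n x) 0

/-- Negative part of the `n`-th Legendre polynomial. -/
noncomputable def legPneg (n : ℕ) (x : ℝ) : ℝ := max (-legP n x) 0

open Polynomial in
noncomputable def legQ (N : ℕ) : ℝ[X] :=
  C (1 / ((2 : ℝ) ^ N * (N.factorial : ℝ))) * derivative^[N] ((X ^ 2 - 1) ^ N)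

open Polynomial in
lemma deriv_iter_poly (p : ℝ[X]) (k : ℕ) :
    deriv^[k] (fun x => p.eval x) = fun x => (derivative^[k] p).eval x := by
  induction k with
  | zero => rfl
  | succ k ih =>
    rw [Function.iterate_succ_apply', ih, Function.iterate_succ_apply']
    funext x
    exact Polynomial.deriv _

open Polynomial in
lemma legP_eq (N : ℕ) (x : ℝ) : legP N x = (legQ N).eval x := by
  unfold legP legQ
  have : (fun y : ℝ => (y ^ 2 - 1) ^ N) = fun y => (((X : ℝ[X]) ^ 2 - 1) ^ N).eval y := by
    funext y; simp
  rw [this, iteratedDeriv_eq_iterate, deriv_iter_poly, eval_mul, eval_C]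

open Polynomial in
lemma ode_aux (N k : ℕ) (W : ℝ[X]) (hW : W = (X ^ 2 - 1) ^ N) :
    (X ^ 2 - 1) * derivative^[k + 2] W + 2 * ((k : ℝ[X]) + 1) * X * derivative^[k + 1] W
      + ((k : ℝ[X]) + 1) * (k : ℝ[X]) * derivative^[k] W
    = 2 * (N : ℝ[X]) * X * derivative^[k + 1] W + 2 * (N : ℝ[X]) * ((k : ℝ[X]) + 1) * derivative^[k] W := by
  have h0 : (X ^ 2 - 1) * derivative W = 2 * (N : ℝ[X]) * X * W := by
    rw [hW, derivative_pow]
    rcases N with _ | N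
    · simp
    · simp [pow_succ]; ring
  induction k with
  | zero =>
    have := congrArg derivative h0
    simp at this
    simp
    linear_combination this
  | succ k ih =>
    have := congrArg derivative ih
    simp only [Function.iterate_succ_apply'] at this ⊢
    simp at this
    push_cast
    linear_combination this

open Polynomial in
lemma legQ_ode (N : ℕ) :
    (1 - X ^ 2) * derivative (derivative (legQ N)) - 2 * X * derivative (legQ N)
      + (N : ℝ[X]) * ((N : ℝ[X]) + 1) * legQ N = 0 := by
  have := ode_aux N N _ rfl
  simp only [Function.iterate_succ_apply'] at this
  unfold legQ
  simp only [derivative_C_mul]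
  linear_combination (-C (1 / ((2 : ℝ) ^ N * (N.factorial : ℝ)))) * this

open Polynomial in
lemma coeffW (N j : ℕ) : (((X : ℝ[X]) ^ 2 - 1) ^ N).coeff j =
    if 2 ∣ j then (-1) ^ (N - j / 2) * (N.choose (j / 2) : ℝ) else 0 := by
  have : (((X : ℝ[X]) ^ 2 - 1) ^ N) = expand ℝ 2 ((X - 1) ^ N) := by simp
  rw [this, coeff_expand (by norm_num)]
  congr 1
  have : ((X : ℝ[X]) - 1) = X + C (-1) := by simp; ring
  rw [this, coeff_X_add_C_pow]

open Polynomial in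
lemma legQ_deriv_zero (m : ℕ) : (derivative (legQ (2 * m))).eval 0 = 0 := by
  unfold legQ
  rw [derivative_C_mul, ← Function.iterate_succ_apply' derivative, eval_mul,
    ← coeff_zero_eq_eval_zero (derivative^[_] _), coeff_iterate_derivative, coeffW, if_neg]
  · simp
  · omega

open Polynomial in
lemma legQ_zero (m : ℕ) : ((legQ (2 * m)).eval 0) ^ 2 = ((m.centralBinom : ℝ) / 4 ^ m) ^ 2 := by
  unfold legQ
  rw [eval_mul,
    ← coeff_zero_eq_eval_zero (derivative^[_] _), coeff_iterate_derivative, coeffW, if_pos (by simp)]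
  simp only [Nat.centralBinom, zero_add, Nat.descFactorial_self, eval_C, nsmul_eq_mul]
  have h : (2 * m) / 2 = m := by omega
  rw [h, show 2 * m - m = m by omega, pow_mul]
  have : ((2 * m).factorial : ℝ) ≠ 0 := by positivity
  norm_num
  field_simp
  rw [← pow_mul, mul_comm m 2, pow_mul]; norm_num

lemma central_bound (m : ℕ) : ((m.centralBinom : ℝ) / 4 ^ m) ^ 2 ≤ 1 / (3 * m + 1) := by
  induction m with
  | zero => simp
  | succ m ih =>
    have h : ((m : ℝ) + 1) * ((m + 1).centralBinom) = 2 * (2 * m + 1) * m.centralBinom := by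
      exact_mod_cast Nat.succ_mul_centralBinom_succ m
    have h2 : (((m + 1).centralBinom : ℝ) / 4 ^ (m + 1)) =
        (2 * m + 1) / (2 * (m + 1)) * (m.centralBinom / 4 ^ m) := by
      rw [pow_succ]; field_simp; linear_combination 2 * h
    rw [h2, mul_pow]
    calc _ ≤ ((2 * (m:ℝ) + 1) / (2 * (m + 1))) ^ 2 * (1 / (3 * m + 1)) := by gcongr
      _ ≤ _ := by
        push_cast
        rw [div_pow, div_mul_div_comm, div_le_div_iff₀ (by positivity) (by positivity)]
        have : (0:ℝ) ≤ m := by positivity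
        nlinarith

open Polynomial in
lemma legQ_shift (N : ℕ) (u : ℝ) : (legQ N).eval (1 - 2 * u) =
    ∑ k ∈ Finset.range (N + 1), (-1) ^ k * ((N.choose k : ℝ) * ((N + k).choose N) * u ^ k) := by
  have h1 := congrArg (Polynomial.map (Int.castRingHom ℝ)) (factorial_mul_shiftedLegendre_eq N)
  rw [← iterate_derivative_map] at h1
  have h3 : ∀ (k : ℕ) (p : ℝ[X]), derivative^[k] (p.comp (1 - 2 * X)) =
      (-2) ^ k * (derivative^[k] p).comp (1 - 2 * X) := by
    intro k p
    induction k with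
    | zero => simp
    | succ k ih =>
      rw [Function.iterate_succ_apply', ih, Function.iterate_succ_apply']
      have : ((-2 : ℝ[X]) ^ k) = C ((-2) ^ k) := by
        have := map_ofNat (C : ℝ →+* ℝ[X]) 2
        simp [this]
      rw [this, derivative_C_mul, derivative_comp, ← this]
      simp
      ring
  have h4 := h3 N ((X ^ 2 - 1) ^ N)
  have h5 : ((X ^ 2 - 1 : ℝ[X]) ^ N).comp (1 - 2 * X) = C ((-4) ^ N) * (X ^ N * (1 - X) ^ N) := by
    have := map_ofNat (C : ℝ →+* ℝ[X]) 4
    simp [← mul_pow, this]; congr 1; ring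
  rw [h5, iterate_derivative_C_mul] at h4
  have h1' := congrArg (eval u) h1
  have h4' := congrArg (eval u) h4
  simp [shiftedLegendre, eval_finsetSum, Polynomial.map_sum] at h1' h4'
  unfold legQ
  rw [eval_mul, eval_C]
  rw [← h1'] at h4'
  have h6 : ((-4 : ℝ)) ^ N = (-2) ^ N * 2 ^ N := by rw [← mul_pow]; norm_num
  rw [h6, mul_assoc] at h4'
  have h7 := mul_left_cancel₀ (pow_ne_zero _ (by norm_num)) h4'
  rw [← h7]
  have : (N.factorial : ℝ) ≠ 0 := by positivity
  field_simp
/-- Abstract Legendre-type function facts. -/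
structure LegFun (L : ℝ) (P D E : ℝ → ℝ) : Prop where
  hP : ∀ x, HasDerivAt P (D x) x
  hD : ∀ x, HasDerivAt D (E x) x
  ode : ∀ x, (1 - x ^ 2) * E x - 2 * x * D x + L * P x = 0
  one : P 1 = 1
  zero : D 0 = 0
  zero' : P 0 ^ 4 ≤ 4 / (9 * L)
  pos : 0 < L

namespace LegFun
variable {L : ℝ} {P D E : ℝ → ℝ}

lemma abs_le_one (h : LegFun L P D E) {x : ℝ} (hx : x ∈ Set.Icc (0:ℝ) 1) : |P x| ≤ 1 := by
  have hd : ∀ x, HasDerivAt (fun x => P x ^ 2 + (1 - x ^ 2) * D x ^ 2 / L)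
      (2 * x * D x ^ 2 / L) x := by
    intro x
    have := ((h.hP x).pow 2).add ((((((hasDerivAt_id x).pow 2).const_sub 1)).mul
      ((h.hD x).pow 2)).div_const L)
    convert! this using 1
    have ho := h.ode x
    have := h.pos
    simp
    field_simp
    linear_combination (-D x) * ho
  have hm : MonotoneOn (fun x => P x ^ 2 + (1 - x ^ 2) * D x ^ 2 / L) (Set.Icc 0 1) := by
    apply monotoneOn_of_deriv_nonneg (convex_Icc _ _)
    · exact fun x _ => (hd x).continuousAt.continuousWithinAt
    · exact fun x _ => (hd x).differentiableAt.differentiableWithinAt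
    · intro x hx
      rw [interior_Icc] at hx
      rw [(hd x).deriv]
      have := h.pos
      have := hx.1
      positivity
  have h1 := hm hx (Set.right_mem_Icc.2 zero_le_one) hx.2
  simp only [h.one] at h1
  rw [show (1 ^ 2 + (1 - 1 ^ 2) * D 1 ^ 2 / L : ℝ) = 1 by ring] at h1
  have : 0 ≤ (1 - x ^ 2) * D x ^ 2 / L := by
    have := h.pos
    have : 0 ≤ 1 - x ^ 2 := by nlinarith [hx.1, hx.2]
    positivity
  rw [← sq_le_one_iff_abs_le_one]
  linarith

lemma deriv_bound (h : LegFun L P D E) {x : ℝ} (hx : x ∈ Set.Ico (0:ℝ) 1) :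
    |D x| ≤ L / (1 + x) := by
  have hd : ∀ x, HasDerivAt (fun x => (1 - x ^ 2) * D x) (- (L * P x)) x := by
    intro x
    have := ((((hasDerivAt_id x).pow 2).const_sub 1)).mul (h.hD x)
    convert! this using 1
    have ho := h.ode x
    simp
    linear_combination -ho
  have := (convex_Icc x 1).norm_image_sub_le_of_norm_hasDerivWithin_le
    (fun y _ => (hd y).hasDerivWithinAt) (C := L) (by
      intro y hy
      have := h.abs_le_one (x := y) ⟨hx.1.trans hy.1, hy.2⟩
      rw [norm_neg, norm_mul, Real.norm_eq_abs, Real.norm_eq_abs, abs_of_pos h.pos]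
      nlinarith [h.pos]) (Set.left_mem_Icc.2 hx.2.le) (Set.right_mem_Icc.2 hx.2.le)
  simp only [Real.norm_eq_abs] at this
  have h1 : 0 < 1 - x := by linarith [hx.2]
  rw [abs_of_pos h1, show (1 - 1 ^ 2) * D 1 - (1 - x ^ 2) * D x = -((1 - x) * ((1 + x) * D x)) by ring,
    abs_neg, abs_mul, abs_of_pos h1, mul_comm L, mul_le_mul_iff_right₀ h1, abs_mul] at this
  have h2 : 0 < 1 + x := by linarith [hx.1]
  rw [abs_of_pos h2] at this
  rw [le_div_iff₀ h2]; linarith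

lemma lower (h : LegFun L P D E) {x : ℝ} (hx : x ∈ Set.Icc (9/11:ℝ) 1) :
    1 - 11 / 20 * L * (1 - x) ≤ P x := by
  have := (convex_Icc x 1).image_sub_le_mul_sub_of_deriv_le (f := P) (C := 11/20 * L)
    (fun y _ => (h.hP y).continuousAt.continuousWithinAt)
    (fun y _ => (h.hP y).differentiableAt.differentiableWithinAt) (by
      intro y hy
      rw [interior_Icc] at hy
      rw [(h.hP y).deriv]
      have h1 : 9/11 < y := lt_of_le_of_lt hx.1 hy.1
      have := (abs_le.1 (h.deriv_bound (x := y) ⟨by linarith, hy.2⟩)).2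
      refine this.trans ?_
      rw [div_le_iff₀ (by linarith)]
      nlinarith [h.pos]) x (Set.left_mem_Icc.2 hx.2) 1 (Set.right_mem_Icc.2 hx.2) hx.2
  rw [h.one] at this
  linarith

lemma lip (h : LegFun L P D E) {x y : ℝ} (hx : 0 ≤ x) (hxy : x ≤ y) (hy : y ≤ 1) :
    P y ≤ P x + L * (y - x) := by
  have := (convex_Icc x y).image_sub_le_mul_sub_of_deriv_le (f := P) (C := L)
    (fun y _ => (h.hP y).continuousAt.continuousWithinAt)
    (fun y _ => (h.hP y).differentiableAt.differentiableWithinAt) (by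
      intro z hz
      rw [interior_Icc] at hz
      rw [(h.hP z).deriv]
      have := (abs_le.1 (h.deriv_bound (x := z) ⟨by linarith [hz.1], by linarith [hz.2]⟩)).2
      refine this.trans ?_
      rw [div_le_iff₀ (by linarith [hz.1])]
      nlinarith [h.pos, hz.1]) x (Set.left_mem_Icc.2 hxy) y (Set.right_mem_Icc.2 hxy) hxy
  linarith

lemma bern (h : LegFun L P D E) {x : ℝ} (hx : x ∈ Set.Icc (0:ℝ) 1) :
    (1 - x ^ 2) * P x ^ 4 ≤ 4 / (9 * L) := by
  have hL := h.pos
  set Q : ℝ → ℝ := fun x => x * P x / 2 - (1 - x ^ 2) * D x with hQ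
  set R : ℝ → ℝ := fun x => (1 - x ^ 2) * (L + 1 / 4) + 1 / 4 with hR
  have hRpos : ∀ x ∈ Set.Icc (0:ℝ) 1, 0 < R x := by
    intro x hx
    have : 0 ≤ 1 - x ^ 2 := by nlinarith [hx.1, hx.2]
    simp only [hR]; positivity
  have dQ : ∀ x, HasDerivAt Q (P x / 2 + x * D x / 2 + L * P x) x := by
    intro x
    have := (((hasDerivAt_id x).mul (h.hP x)).div_const 2).sub
      (((((hasDerivAt_id x).pow 2).const_sub 1)).mul (h.hD x))
    convert! this using 1
    have ho := h.ode x
    simp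
    linear_combination ho
  have dR : ∀ x, HasDerivAt R (-(2 * x) * (L + 1 / 4)) x := by
    intro x
    have := (((((hasDerivAt_id x).pow 2).const_sub 1)).mul_const (L + 1/4)).add_const (1/4)
    convert! this using 1
    simp
  set H : ℝ → ℝ := fun x => P x ^ 2 + Q x ^ 2 / R x with hH
  have dH : ∀ x ∈ Set.Icc (0:ℝ) 1, HasDerivAt H (2 * P x * D x +
      (2 * Q x * (P x / 2 + x * D x / 2 + L * P x) * R x - Q x ^ 2 * (-(2 * x) * (L + 1 / 4))) / R x ^ 2) x := by
    intro x hx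
    have := ((h.hP x).pow 2).add (((dQ x).pow 2).div (dR x) (hRpos x hx).ne')
    convert! this using 1
    simp
  have dG : ∀ x ∈ Set.Icc (0:ℝ) 1, HasDerivAt (fun x => (1 - x ^ 2) * H x ^ 2)
      (2 * H x * (- (x * Q x ^ 2 / (2 * R x ^ 2)))) x := by
    intro x hx
    have := ((((hasDerivAt_id x).pow 2).const_sub 1)).mul ((dH x hx).pow 2)
    convert! this using 1
    have h0 := (hRpos x hx).ne'
    have key : (1 - x ^ 2) * (2 * P x * D x +
      (2 * Q x * (P x / 2 + x * D x / 2 + L * P x) * R x - Q x ^ 2 * (-(2 * x) * (L + 1 / 4))) / R x ^ 2)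
        - x * H x = - (x * Q x ^ 2 / (2 * R x ^ 2)) := by
      have e1 : (1 - x ^ 2) * D x = x * P x / 2 - Q x := by simp only [hQ]; ring
      have e2 : (1 - x ^ 2) * (P x / 2 + x * D x / 2 + L * P x) = R x * P x - x * Q x / 2 := by
        simp only [hQ, hR]; ring
      have e3 : (1 - x ^ 2) * (L + 1 / 4) = R x - 1 / 4 := by simp only [hR]; ring
      have e4 : H x = P x ^ 2 + Q x ^ 2 / R x := rfl
      rw [e4]
      generalize Q x = q at *
      generalize R x = r at *
      field_simp
      linear_combination (16 * P x * r ^ 2) * e1 + (16 * q * r) * e2 + 16 * q ^ 2 * x * e3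
    rw [← key]
    simp
    ring
  have ha : AntitoneOn (fun x => (1 - x ^ 2) * H x ^ 2) (Set.Icc 0 1) := by
    apply antitoneOn_of_deriv_nonpos (convex_Icc _ _)
    · exact fun x hx => (dG x hx).continuousAt.continuousWithinAt
    · exact fun x hx => (dG x (interior_subset hx)).differentiableAt.differentiableWithinAt
    · intro x hx
      have hx := interior_subset hx
      rw [(dG x hx).deriv]
      have := hRpos x hx
      have : 0 ≤ H x := by simp only [hH]; positivity
      have : 0 ≤ x * Q x ^ 2 / (2 * R x ^ 2) := by have := hx.1; positivity
      nlinarith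
  have h1 := ha (Set.left_mem_Icc.2 zero_le_one) hx hx.1
  have h2 : H 0 = P 0 ^ 2 := by simp [hH, hQ, h.zero]
  simp only [h2] at h1
  have h3 : P x ^ 2 ≤ H x := by
    have := hRpos x hx
    simp only [hH]
    have : 0 ≤ Q x ^ 2 / R x := by positivity
    linarith
  have h4 : 0 ≤ 1 - x ^ 2 := by nlinarith [hx.1, hx.2]
  calc (1 - x ^ 2) * P x ^ 4 = (1 - x ^ 2) * (P x ^ 2) ^ 2 := by ring
    _ ≤ (1 - x ^ 2) * H x ^ 2 := by gcongr
    _ ≤ P 0 ^ 4 := by linarith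
    _ ≤ _ := h.zero'

end LegFun

open Polynomial in
lemma legFun_legQ (m : ℕ) (hm : 1 ≤ m) : LegFun ((2 * m : ℝ) * (2 * m + 1))
    (fun x => (legQ (2 * m)).eval x) (fun x => (derivative (legQ (2 * m))).eval x)
    (fun x => (derivative (derivative (legQ (2 * m)))).eval x) where
  hP x := Polynomial.hasDerivAt _ x
  hD x := Polynomial.hasDerivAt _ x
  ode x := by
    have := congrArg (eval x) (legQ_ode (2 * m))
    simp at this
    linear_combination this
  one := by
    have := legQ_shift (2 * m) 0
    rw [Finset.sum_eq_single 0] at this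
    · simpa using this
    · intro b _ hb; simp [hb]
    · simp
  zero := legQ_deriv_zero m
  zero' := by
    have h := legQ_zero m
    have h2 := central_bound m
    rw [← h] at h2
    have hm' : (1:ℝ) ≤ m := by exact_mod_cast hm
    calc (eval 0 (legQ (2 * m))) ^ 4 = (eval (0:ℝ) (legQ (2 * m)) ^ 2) ^ 2 := by rw [← pow_mul]
      _ ≤ (1 / (3 * (m:ℝ) + 1)) ^ 2 := by gcongr
      _ ≤ _ := by
        rw [div_pow, div_le_div_iff₀ (by positivity) (by positivity)]
        nlinarith
  pos := by
    have : (1:ℝ) ≤ m := by exact_mod_cast hm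
    positivity

lemma legQ_neg (N : ℕ) (hN : 20 ≤ N) :
    (legQ N).eval (1 - 2 * (3 / ((N : ℝ) * (N + 1)))) ≤ - (1 / 4) := by
  have hN' : (20:ℝ) ≤ N := by exact_mod_cast hN
  set L : ℝ := (N : ℝ) * (N + 1) with hL
  have hL0 : 400 ≤ L := by nlinarith
  set b : ℕ → ℝ := fun k => (N.choose k : ℝ) * ((N + k).choose N) * (3 / L) ^ k with hb
  have hbn : ∀ k, 0 ≤ b k := fun k => by simp only [hb]; positivity
  have hrec : ∀ k, k ≤ N → b (k + 1) = b k * (3 * (1 - k * (k + 1) / L) / (k + 1) ^ 2) := by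
    intro k hk
    have h1 : (N.choose (k + 1) : ℝ) * (k + 1) = N.choose k * (N - k) := by
      have := Nat.choose_succ_right_eq N k
      have h2 : ((N - k : ℕ) : ℝ) = N - k := by push_cast [hk]; ring
      rw [← h2]; exact_mod_cast this
    have h2 : ((N + (k + 1)).choose N : ℝ) * (k + 1) = (N + k).choose N * (N + k + 1) := by
      have h3 := Nat.add_one_mul_choose_eq (N + k) k
      have e1 : (N + k).choose k = (N + k).choose N := by
        rw [Nat.choose_symm_add]
      have e2 : (N + k).succ.choose k.succ = (N + (k + 1)).choose N := by
        rw [show (N + k).succ = N + (k + 1) by omega, Nat.choose_symm_add]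
      rw [e1, e2] at h3
      have h4 : ((N + k).succ : ℝ) * (N + k).choose N = (N + (k + 1)).choose N * (k.succ : ℝ) := by
        exact_mod_cast h3
      push_cast at h4
      linarith
    have h1' : (N.choose (k + 1) : ℝ) = N.choose k * (N - k) / (k + 1) := by
      field_simp; linarith
    have h2' : ((N + (k + 1)).choose N : ℝ) = (N + k).choose N * (N + k + 1) / (k + 1) := by
      field_simp; linarith
    simp only [hb]
    rw [h1', h2', pow_succ]
    field_simp
    rw [hL]; ring
  have b0 : b 0 = 1 := by simp [hb]
  have b1 : b 1 = 3 := by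
    have := hrec 0 (by omega); rw [b0] at this; simpa using this
  have hle : ∀ k, k ≤ N → b (k + 1) ≤ b k * (3 / (k + 1) ^ 2) := by
    intro k hk
    rw [hrec k hk]
    apply mul_le_mul_of_nonneg_left _ (hbn k)
    gcongr
    have : 0 ≤ (k : ℝ) * (k + 1) / L := by positivity
    linarith
  have b2 : b 2 ≤ 9 / 4 := by
    have := hle 1 (by omega); rw [b1] at this; norm_num at this ⊢; linarith
  have b3 : 73 / 100 ≤ b 3 := by
    have h2 := hrec 1 (by omega)
    have h3 := hrec 2 (by omega)
    norm_num at h2 h3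
    have e : L⁻¹ ≤ 1 / 400 := by rw [← one_div]; gcongr
    have e0 : 0 < L⁻¹ := by positivity
    rw [h3, h2, b1]
    simp only [div_eq_mul_inv]
    nlinarith
  have b3u : b 3 ≤ 3 / 4 := by
    have := hle 2 (by omega); norm_num at this ⊢; linarith
  have b4u : b 4 ≤ 9 / 64 := by
    have := hle 3 (by omega); norm_num at this ⊢; linarith
  have b5u : b 5 ≤ 1 / 50 := by
    have := hle 4 (by omega); norm_num at this ⊢; linarith
  have btail : ∀ k, k + 5 ≤ N + 1 → b (k + 5) ≤ 1 / 50 * (1 / 2) ^ k := by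
    intro k
    induction k with
    | zero => intro _; simpa using b5u
    | succ k ih =>
      intro hk
      have h1 := ih (by omega)
      have h2 := hle (k + 5) (by omega)
      rw [show k + 1 + 5 = k + 5 + 1 by ring]
      have h3 : (3 : ℝ) / (((k + 5 : ℕ) : ℝ) + 1) ^ 2 ≤ 1 / 2 := by
        rw [div_le_div_iff₀ (by positivity) (by norm_num)]
        push_cast
        nlinarith [(Nat.cast_nonneg k : (0:ℝ) ≤ k)]
      calc _ ≤ _ := h2
        _ ≤ b (k + 5) * (1 / 2) := mul_le_mul_of_nonneg_left h3 (hbn _)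
        _ ≤ _ := by rw [pow_succ]; linarith
  rw [legQ_shift]
  change ∑ k ∈ Finset.range (N + 1), (-1) ^ k * b k ≤ _
  obtain ⟨M, rfl⟩ : ∃ M, N = M + 4 := ⟨N - 4, by omega⟩
  rw [show M + 4 + 1 = 5 + M by ring, Finset.sum_range_add]
  have ht : ∑ x ∈ Finset.range M, (-1) ^ (5 + x) * b (5 + x) ≤ 1 / 50 * 2 := by
    calc _ ≤ ∑ x ∈ Finset.range M, 1 / 50 * (1 / 2 : ℝ) ^ x := by
          apply Finset.sum_le_sum
          intro x hx
          rw [Finset.mem_range] at hx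
          have h1 := btail x (by omega)
          rw [add_comm 5 x]
          refine le_trans ?_ h1
          have : (-1 : ℝ) ^ (x + 5) ≤ 1 := by
            rcases neg_one_pow_eq_or ℝ (x + 5) with h | h <;> rw [h]; norm_num
          nlinarith [hbn (x + 5)]
      _ = 1 / 50 * ∑ x ∈ Finset.range M, (1 / 2 : ℝ) ^ x := by rw [Finset.mul_sum]
      _ ≤ _ := by gcongr; exact sum_geometric_two_le M
  simp only [Finset.sum_range_succ, Finset.sum_range_zero]
  rw [b0, b1]
  norm_num
  linarith
namespace LegFun
variable {L : ℝ} {P D E : ℝ → ℝ}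

lemma cont (h : LegFun L P D E) : Continuous P :=
  continuous_iff_continuousAt.2 fun x => (h.hP x).continuousAt

lemma int6 (h : LegFun L P D E) (hL : 400 ≤ L) :
    ∫ x in (0:ℝ)..(1 - 20 / (11 * L)), P x ^ 6 ≤ 4 / (25 * L) := by
  have hL0 := h.pos
  set x0 := 1 - 20 / (11 * L) with hx0
  have hq : 20 / (11 * L) ≤ 1 / 200 := by
    rw [div_le_div_iff₀ (by positivity) (by norm_num)]; linarith
  have hq0 : 0 < 20 / (11 * L) := by positivity
  have hx0p : 0 ≤ x0 := by rw [hx0]; linarith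
  have hx0l : x0 < 1 := by rw [hx0]; linarith
  set k := 2 / (3 * √L) with hk
  have hkp : 0 < k := by positivity
  have hk2 : k ^ 2 = 4 / (9 * L) := by
    rw [hk, div_pow, mul_pow, Real.sq_sqrt hL0.le]; norm_num
  have hpos : ∀ x ∈ Set.Icc 0 x0, 0 < 1 - x ^ 2 := by
    intro x hx; nlinarith [hx.1, hx.2]
  have hd : ∀ x ∈ Set.uIcc 0 x0, HasDerivAt (fun x => k ^ 3 * (x / √(1 - x ^ 2)))
      (k ^ 3 / √(1 - x ^ 2) ^ 3) x := by
    intro x hx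
    rw [Set.uIcc_of_le hx0p] at hx
    have h1 := hpos x hx
    have h2 := ((((hasDerivAt_id x).pow 2).const_sub 1)).sqrt (by simpa using h1.ne')
    have h3 := ((hasDerivAt_id x).div h2 (by simpa using (Real.sqrt_pos.2 h1).ne')).const_mul (k ^ 3)
    convert! h3 using 1
    simp
    have h4 : √(1 - x ^ 2) ^ 2 = 1 - x ^ 2 := Real.sq_sqrt h1.le
    have h5 := (Real.sqrt_pos.2 h1).ne'
    generalize √(1 - x ^ 2) = s at *
    field_simp
    linear_combination -h4
  have hc : ContinuousOn (fun x => k ^ 3 / √(1 - x ^ 2) ^ 3) (Set.uIcc 0 x0) := by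
    apply ContinuousOn.div (by fun_prop) (by fun_prop)
    intro x hx
    rw [Set.uIcc_of_le hx0p] at hx
    have := Real.sqrt_pos.2 (hpos x hx)
    positivity
  calc ∫ x in (0:ℝ)..x0, P x ^ 6 ≤ ∫ x in (0:ℝ)..x0, k ^ 3 / √(1 - x ^ 2) ^ 3 := by
        apply intervalIntegral.integral_mono_on hx0p
        · exact (h.cont.pow 6).intervalIntegrable _ _
        · exact hc.intervalIntegrable
        · intro x hx
          have h1 := hpos x hx
          have h2 := Real.sqrt_pos.2 h1
          have h3 := h.bern (x := x) ⟨hx.1, hx.2.trans hx0l.le⟩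
          rw [← hk2] at h3
          have h4 : √(1 - x ^ 2) * P x ^ 2 ≤ k := by
            apply le_of_pow_le_pow_left₀ two_ne_zero hkp.le
            rw [mul_pow, Real.sq_sqrt h1.le, ← pow_mul]; exact h3
          rw [le_div_iff₀ (by positivity)]
          calc P x ^ 6 * √(1 - x ^ 2) ^ 3 = (√(1 - x ^ 2) * P x ^ 2) ^ 3 := by ring
            _ ≤ k ^ 3 := by gcongr
    _ = k ^ 3 * (x0 / √(1 - x0 ^ 2)) := by
        rw [intervalIntegral.integral_eq_sub_of_hasDerivAt hd hc.intervalIntegrable]; simp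
    _ ≤ k ^ 3 * (1 / √(1 - x0 ^ 2)) := by gcongr
    _ ≤ 4 / (25 * L) := by
        have h1 := hpos x0 ⟨hx0p, le_rfl⟩
        have h2 := Real.sqrt_pos.2 h1
        apply le_of_pow_le_pow_left₀ two_ne_zero (by positivity)
        rw [mul_pow, div_pow 1, Real.sq_sqrt h1.le, ← pow_mul, mul_comm 3 2, pow_mul, hk2]
        have h3 : 1 - x0 ^ 2 = 20 / (11 * L) * (2 - 20 / (11 * L)) := by rw [hx0]; ring
        have h4 : 20 / (11 * L) * (199 / 100) ≤ 1 - x0 ^ 2 := by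
          rw [h3]; gcongr; linarith
        calc (4 / (9 * L)) ^ 3 * (1 ^ 2 / (1 - x0 ^ 2))
            ≤ (4 / (9 * L)) ^ 3 * (1 ^ 2 / (20 / (11 * L) * (199 / 100))) := by gcongr
          _ ≤ _ := by
            rw [div_pow, div_pow]
            field_simp
            norm_num

lemma small (h : LegFun L P D E) (hL : 400 ≤ L) {x : ℝ} (hx : 0 ≤ x)
    (hx' : x ≤ 1 - 20 / (11 * L)) : |P x| ≤ 3 / 5 := by
  have hL0 := h.pos
  have hq : 20 / (11 * L) ≤ 1 / 200 := by
    rw [div_le_div_iff₀ (by positivity) (by norm_num)]; linarith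
  have hq0 : 0 < 20 / (11 * L) := by positivity
  have h3 := h.bern (x := x) ⟨hx, by linarith⟩
  have h4 : 20 / (11 * L) * (199 / 100) ≤ 1 - x ^ 2 := by nlinarith
  have h5 : 20 / (11 * L) * (199 / 100) * P x ^ 4 ≤ 4 / (9 * L) :=
    le_trans (by gcongr) h3
  have h6 : P x ^ 4 ≤ (3 / 5) ^ 4 := by
    field_simp at h5
    norm_num
    nlinarith
  have : |P x| ^ 4 ≤ (3 / 5) ^ 4 := by rwa [Even.pow_abs (by decide)]
  exact le_of_pow_le_pow_left₀ (by norm_num) (by norm_num) this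

lemma rpow_le6 {v m p : ℝ} (hp : 6 ≤ p) (hv : 0 ≤ v) (hm : v ≤ m) :
    v ^ p ≤ m ^ (p - 6) * v ^ 6 := by
  have : v ^ p = v ^ (p - 6) * v ^ 6 := by
    rw [← Real.rpow_natCast v 6, ← Real.rpow_add_of_nonneg hv (by linarith) (by norm_num)]
    congr 1; push_cast; ring
  rw [this]
  gcongr

lemma rpow_ge6 {v m p : ℝ} (hp : 6 ≤ p) (hm0 : 0 ≤ m) (hm : m ≤ v) :
    m ^ (p - 6) * v ^ 6 ≤ v ^ p := by
  have hv := hm0.trans hm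
  have : v ^ p = v ^ (p - 6) * v ^ 6 := by
    rw [← Real.rpow_natCast v 6, ← Real.rpow_add_of_nonneg hv (by linarith) (by norm_num)]
    congr 1; push_cast; ring
  rw [this]
  gcongr

lemma main (h : LegFun L P D E) (hL : 400 ≤ L) (hneg : P (1 - 6 / L) ≤ - (1 / 4))
    (p : ℝ) (hp : 6 ≤ p) :
    3 / 2 ≤ (∫ x in (0:ℝ)..1, (max (P x) 0) ^ p) / (∫ x in (0:ℝ)..1, (max (-P x) 0) ^ p) ∧
    (∫ x in (0:ℝ)..1, (max (P x) 0) ^ p) / (∫ x in (0:ℝ)..1, (max (-P x) 0) ^ p)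
      ≤ 24 * 8 ^ p := by
  have hL0 := h.pos
  have hp0 : 0 ≤ p := by linarith
  have cp : Continuous fun x => (max (P x) 0) ^ p :=
    (h.cont.max continuous_const).rpow_const fun _ => Or.inr hp0
  have cn : Continuous fun x => (max (-P x) 0) ^ p :=
    (h.cont.neg.max continuous_const).rpow_const fun _ => Or.inr hp0
  have hq : 20 / (11 * L) ≤ 1 / 200 := by
    rw [div_le_div_iff₀ (by positivity) (by norm_num)]; linarith
  have hq0 : 0 < 20 / (11 * L) := by positivity
  have h6 := h.int6 hL
  have hsm := fun x hx hx' => h.small hL (x := x) hx hx'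
  have hlow : ∀ x, 1 - 20 / (11 * L) ≤ x → x ≤ 1 → 1 - 11 / 20 * L * (1 - x) ≤ P x := by
    intro x hx hx'
    exact h.lower ⟨by linarith, hx'⟩
  set x0 := 1 - 20 / (11 * L) with hx0
  have hx0p : 0 ≤ x0 := by rw [hx0]; linarith
  have hx0l : x0 ≤ 1 := by rw [hx0]; linarith
  set m : ℝ := (3 / 5 : ℝ) ^ (p - 6) with hm
  have hmp : 0 < m := by positivity
  -- numerator lower bound
  have hn1 : m * (1 / (4 * L)) ≤ ∫ x in (0:ℝ)..1, (max (P x) 0) ^ p := by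
    set x1 := 1 - 8 / (11 * L) with hx1
    have e1 : 20 / (11 * L) = 5 / 2 * (8 / (11 * L)) := by ring
    have hx1p : x0 ≤ x1 := by rw [hx0, hx1]; linarith
    have hx1l : x1 ≤ 1 := by rw [hx1]; linarith
    have hd : ∀ x, HasDerivAt (fun x => 20 / (77 * L) * (1 - 11 / 20 * L * (1 - x)) ^ 7)
        ((1 - 11 / 20 * L * (1 - x)) ^ 6) x := by
      intro x
      have := ((((((hasDerivAt_id x).const_sub 1)).const_mul (11 / 20 * L)).const_sub 1).pow 7).const_mul
        (20 / (77 * L))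
      convert! this using 1
      simp
      field_simp
      ring
    have hi : ∫ x in x1..1, (1 - 11 / 20 * L * (1 - x)) ^ 6 = 20 / (77 * L) * (1 - (3 / 5) ^ 7) := by
      rw [intervalIntegral.integral_eq_sub_of_hasDerivAt (fun x _ => hd x)
        (Continuous.intervalIntegrable (by fun_prop) _ _)]
      have : 1 - 11 / 20 * L * (1 - x1) = 3 / 5 := by rw [hx1]; field_simp; norm_num
      rw [this]; ring
    calc m * (1 / (4 * L)) ≤ m * (20 / (77 * L) * (1 - (3 / 5) ^ 7)) := by
          gcongr
          rw [div_mul_eq_mul_div, div_le_div_iff₀ (by positivity) (by positivity)]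
          norm_num
          nlinarith
      _ = ∫ x in x1..1, m * (1 - 11 / 20 * L * (1 - x)) ^ 6 := by
          rw [intervalIntegral.integral_const_mul, hi]
      _ ≤ ∫ x in x1..1, (max (P x) 0) ^ p := by
          apply intervalIntegral.integral_mono_on hx1l
            (Continuous.intervalIntegrable (by fun_prop) _ _) (cp.intervalIntegrable _ _)
          intro x hx
          have h1 := hlow x (hx1p.trans hx.1) hx.2
          have h2 : 3 / 5 ≤ 1 - 11 / 20 * L * (1 - x) := by
            have : 1 - 11 / 20 * L * (1 - x1) = 3 / 5 := by rw [hx1]; field_simp; norm_num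
            rw [← this]
            have := hx.1
            gcongr
          calc _ ≤ (1 - 11 / 20 * L * (1 - x)) ^ p := rpow_ge6 hp (by norm_num) h2
            _ ≤ _ := by
              apply Real.rpow_le_rpow (by linarith) _ hp0
              exact h1.trans (le_max_left _ _)
      _ ≤ _ := by
          apply intervalIntegral.integral_mono_interval (hx0p.trans hx1p) hx1l le_rfl _
            (cp.intervalIntegrable _ _)
          exact Filter.Eventually.of_forall fun x => by positivity
  -- denominator upper bound
  have hd1 : ∫ x in (0:ℝ)..1, (max (-P x) 0) ^ p ≤ m * (4 / (25 * L)) := by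
    rw [← intervalIntegral.integral_add_adjacent_intervals (cn.intervalIntegrable 0 x0)
      (cn.intervalIntegrable x0 1)]
    have z : ∫ x in x0..1, (max (-P x) 0) ^ p ≤ ∫ x in x0..1, (0:ℝ) := by
      apply intervalIntegral.integral_mono_on hx0l (cn.intervalIntegrable _ _)
        (by simp)
      intro x hx
      have h1 := hlow x hx.1 hx.2
      have h2 : 0 ≤ 1 - 11 / 20 * L * (1 - x) := by
        have : 1 - 11 / 20 * L * (1 - x0) = 0 := by rw [hx0]; field_simp; norm_num
        rw [← this]
        have := hx.1
        gcongr
      rw [max_eq_right (by linarith), Real.zero_rpow (by linarith)]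
    have y : ∫ x in (0:ℝ)..x0, (max (-P x) 0) ^ p ≤ ∫ x in (0:ℝ)..x0, m * P x ^ 6 := by
      apply intervalIntegral.integral_mono_on hx0p (cn.intervalIntegrable _ _)
        ((continuous_const.mul (h.cont.pow 6)).intervalIntegrable _ _)
      intro x hx
      have h1 := abs_le.1 (hsm x hx.1 hx.2)
      refine (rpow_le6 hp (le_max_right _ _) (m := 3 / 5) ?_).trans ?_
      · exact max_le (by linarith) (by norm_num)
      · change m * _ ≤ m * P x ^ 6
        refine mul_le_mul_of_nonneg_left ?_ hmp.le
        rw [← Even.pow_abs (by decide : Even 6) (P x)]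
        gcongr
        exact max_le (neg_le_abs _) (abs_nonneg _)
    rw [intervalIntegral.integral_const_mul] at y
    have : m * (∫ x in (0:ℝ)..x0, P x ^ 6) ≤ m * (4 / (25 * L)) := by gcongr
    simp only [intervalIntegral.integral_zero] at z
    linarith
  -- numerator upper bound
  have hn2 : ∫ x in (0:ℝ)..1, (max (P x) 0) ^ p ≤ 3 / L := by
    rw [← intervalIntegral.integral_add_adjacent_intervals (cp.intervalIntegrable 0 x0)
      (cp.intervalIntegrable x0 1)]
    have z : ∫ x in x0..1, (max (P x) 0) ^ p ≤ ∫ x in x0..1, (1:ℝ) := by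
      apply intervalIntegral.integral_mono_on hx0l (cp.intervalIntegrable _ _)
        (by simp)
      intro x hx
      have h1 := abs_le.1 (h.abs_le_one (x := x) ⟨hx0p.trans hx.1, hx.2⟩)
      exact Real.rpow_le_one (le_max_right _ _) (max_le h1.2 zero_le_one) hp0
    have y : ∫ x in (0:ℝ)..x0, (max (P x) 0) ^ p ≤ ∫ x in (0:ℝ)..x0, P x ^ 6 := by
      apply intervalIntegral.integral_mono_on hx0p (cp.intervalIntegrable _ _)
        ((h.cont.pow 6).intervalIntegrable _ _)
      intro x hx
      have h1 := abs_le.1 (h.abs_le_one (x := x) ⟨hx.1, hx.2.trans hx0l⟩)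
      refine (rpow_le6 hp (le_max_right _ _) (m := 1) ?_).trans ?_
      · exact max_le (by linarith) (by norm_num)
      · change _ ≤ P x ^ 6
        rw [Real.one_rpow, one_mul, ← Even.pow_abs (by decide : Even 6) (P x)]
        gcongr
        exact max_le (le_abs_self _) (abs_nonneg _)
    simp only [intervalIntegral.integral_const, smul_eq_mul, mul_one] at z
    have e : 4 / (25 * L) + (1 - x0) ≤ 3 / L := by
      rw [hx0]; field_simp; norm_num
    linarith
  -- denominator lower bound
  have hd2 : (1 / 8 : ℝ) ^ p * (1 / (8 * L)) ≤ ∫ x in (0:ℝ)..1, (max (-P x) 0) ^ p := by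
    have e1 : 6 / L ≤ 1 / 10 := by rw [div_le_div_iff₀ hL0 (by norm_num)]; linarith
    have e2 : 1 / (8 * L) ≤ 6 / L := by
      rw [div_le_div_iff₀ (by positivity) hL0]; linarith
    have e0 : 0 < 1 / (8 * L) := by positivity
    calc (1 / 8 : ℝ) ^ p * (1 / (8 * L))
        = ∫ x in (1 - 6 / L)..(1 - 6 / L + 1 / (8 * L)), (1 / 8 : ℝ) ^ p := by
          rw [intervalIntegral.integral_const, smul_eq_mul]; ring
      _ ≤ ∫ x in (1 - 6 / L)..(1 - 6 / L + 1 / (8 * L)), (max (-P x) 0) ^ p := by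
          apply intervalIntegral.integral_mono_on (by linarith) (by simp)
            (cn.intervalIntegrable _ _)
          intro x hx
          have h1 := h.lip (x := 1 - 6 / L) (y := x) (by linarith) hx.1 (by linarith [hx.2])
          have h2 : L * (x - (1 - 6 / L)) ≤ L * (1 / (8 * L)) := by
            gcongr; linarith [hx.2]
          have h3 : L * (1 / (8 * L)) = 1 / 8 := by field_simp
          apply Real.rpow_le_rpow (by norm_num) _ hp0
          exact le_trans (by linarith) (le_max_left _ _)
      _ ≤ _ := by
          apply intervalIntegral.integral_mono_interval (by linarith) (by linarith) (by linarith) _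
            (cn.intervalIntegrable _ _)
          exact Filter.Eventually.of_forall fun x => by positivity
  have hdp : 0 < ∫ x in (0:ℝ)..1, (max (-P x) 0) ^ p := lt_of_lt_of_le (by positivity) hd2
  constructor
  · rw [le_div_iff₀ hdp]
    refine le_trans ?_ hn1
    calc _ ≤ 3 / 2 * (m * (4 / (25 * L))) := by gcongr
      _ = m * (6 / (25 * L)) := by ring
      _ ≤ _ := by
        gcongr m * ?_
        rw [div_le_div_iff₀ (by positivity) (by positivity)]; nlinarith
  · rw [div_le_iff₀ hdp]
    refine hn2.trans ?_
    calc 3 / L = 24 * 8 ^ p * ((1 / 8 : ℝ) ^ p * (1 / (8 * L))) := by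
          rw [one_div, Real.inv_rpow (by norm_num)]
          have : (0:ℝ) < 8 ^ p := by positivity
          field_simp
          norm_num
      _ ≤ _ := by gcongr

end LegFun

/-- Failure of asymptotic $L^p$ symmetry: for $p ≥ 6$, the liminf of the ratio of
$p$-th power integrals of the positive and negative parts of $P_{4n}$ exceeds 1. -/
theorem liminf_ratio_gt_one (p : ℝ) (hp : 6 ≤ p) :
    1 < Filter.liminf (fun n : ℕ =>
      (∫ x in (0:ℝ)..1, (legPpos (4 * n) x) ^ p) /
      (∫ x in (0:ℝ)..1, (legPneg (4 * n) x) ^ p)) Filter.atTop := by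
  have key : ∀ n : ℕ, 5 ≤ n →
      3 / 2 ≤ (∫ x in (0:ℝ)..1, (legPpos (4 * n) x) ^ p) /
        (∫ x in (0:ℝ)..1, (legPneg (4 * n) x) ^ p) ∧
      (∫ x in (0:ℝ)..1, (legPpos (4 * n) x) ^ p) /
        (∫ x in (0:ℝ)..1, (legPneg (4 * n) x) ^ p) ≤ 24 * 8 ^ p := by
    intro n hn
    have h1 := legFun_legQ (2 * n) (by omega)
    have h2 := legQ_neg (4 * n) (by omega)
    have hn' : (5:ℝ) ≤ n := by exact_mod_cast hn
    rw [show 2 * (2 * n) = 4 * n by ring] at h1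
    simp only [legPpos, legPneg, legP_eq]
    refine h1.main ?_ ?_ p hp
    · push_cast; nlinarith
    · convert h2 using 2
      push_cast
      ring
  have hev : ∀ᶠ n : ℕ in atTop, 5 ≤ n := eventually_ge_atTop 5
  refine lt_of_lt_of_le (by norm_num : (1:ℝ) < 3 / 2) ?_
  apply le_liminf_of_le
  · apply IsCoboundedUnder.of_frequently_le (a := 24 * 8 ^ p)
    exact (hev.mono fun n hn => (key n hn).2).frequently
  · exact hev.mono fun n hn => (key n hn).1
end

section
/- For every integer n ≥ 1, every integer m with 1 ≤ m ≤ n, and every real x with z_n ≤ x ≤ 1, one has P_n(x) ≤ P_m(x); in particular P_1(x) = x ≥ P_2(x) ≥ … ≥ P_n(x) on [z_n, 1]. -/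
open MeasureTheory Filter

open Polynomial in
theorem legAux_iter (k : ℕ) (f : ℝ[X]) :
    derivative^[k+1] (X * f) = X * derivative^[k+1] f + ((k:ℝ[X])+1) * derivative^[k] f := by
  induction k with
  | zero => simp [derivative_mul]; ring
  | succ k ih =>
    rw [Function.iterate_succ_apply', ih, Function.iterate_succ_apply' _ (k+1) f,
      Function.iterate_succ_apply' _ k f]
    simp only [derivative_add, derivative_mul, derivative_X, derivative_natCast, derivative_one]
    push_cast
    ring

open Polynomial in
theorem legAux_eq (n : ℕ) (x : ℝ) :
    legP n x = (derivative^[n] ((X ^ 2 - 1 : ℝ[X]) ^ n)).eval x / ((2 : ℝ) ^ n * (n.factorial : ℝ)) := by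
  have h : ∀ (n : ℕ) (p : ℝ[X]), iteratedDeriv n (fun y => p.eval y) =
      fun y => (derivative^[n] p).eval y := by
    intro n p
    induction n with
    | zero => simp
    | succ k ih =>
      rw [iteratedDeriv_succ, ih, Function.iterate_succ_apply']
      funext y
      exact Polynomial.deriv _
  have h2 := congrFun (h n ((X ^ 2 - 1 : ℝ[X]) ^ n)) x
  simp only [eval_pow, eval_sub, eval_X, eval_one] at h2
  rw [legP, h2]
  ring

theorem legAux_cont (n : ℕ) : Continuous (legP n) := by
  have : legP n = fun x => _ := funext (legAux_eq n)
  rw [this]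
  fun_prop

theorem legAux_zero (x : ℝ) : legP 0 x = 1 := by
  rw [legAux_eq]; simp

theorem legAux_one (x : ℝ) : legP 1 x = x := by
  rw [legAux_eq]; simp; ring

open Polynomial in
theorem legAux_rec (k : ℕ) (x : ℝ) :
    ((k:ℝ)+2) * legP (k+2) x = (2*k+3) * x * legP (k+1) x - (k+1) * legP k x := by
  set u : ℝ[X] := X ^ 2 - 1 with hu
  have hd : ∀ j : ℕ, derivative (u ^ (j+1)) = C (2 * ((j:ℝ)+1)) * (X * u ^ j) := by
    intro j
    rw [derivative_pow_succ, hu]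
    simp only [derivative_sub, derivative_X_pow, derivative_one, map_mul, map_add, map_natCast,
      map_one, map_ofNat]
    push_cast
    ring
  have e1 : derivative^[k+2] (u ^ (k+2)) = C (2 * ((k:ℝ)+2)) *
      (X * derivative^[k+1] (u ^ (k+1)) + ((k:ℝ[X])+1) * derivative^[k] (u ^ (k+1))) := by
    rw [Function.iterate_succ_apply, hd (k+1), iterate_derivative_C_mul, legAux_iter]
    push_cast
    congr 2
    ring
  have e2 : derivative^[k+2] (u ^ (k+2)) = C (2 * ((k:ℝ)+2) * (2*k+3)) * derivative^[k] (u ^ (k+1))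
      + C (4 * ((k:ℝ)+1)*(k+2)) * derivative^[k] (u ^ k) := by
    rw [Function.iterate_succ_apply, Function.iterate_succ_apply, ← iterate_derivative_C_mul,
      ← iterate_derivative_C_mul, ← iterate_map_add]
    congr 1
    rw [hd (k+1), derivative_C_mul, derivative_mul, hd k, derivative_X]
    have : (X:ℝ[X]) * X = u + 1 := by rw [hu]; ring
    simp only [map_mul, map_add, map_natCast, map_one, map_ofNat]
    push_cast
    linear_combination (4 * ((k:ℝ[X])+1) * (k+2) * u ^ k) * this
  rw [legAux_eq, legAux_eq, legAux_eq, ← hu]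
  have f1 := congrArg (eval x) e1
  have f2 := congrArg (eval x) e2
  simp only [eval_mul, eval_add, eval_C, eval_X, eval_natCast, eval_one] at f1 f2
  generalize eval x (derivative^[k+2] (u ^ (k+2))) = A at *
  generalize eval x (derivative^[k+1] (u ^ (k+1))) = B at *
  generalize eval x (derivative^[k] (u ^ (k+1))) = E at *
  generalize eval x (derivative^[k] (u ^ k)) = F at *
  have hA : A = 2*((2*k+3)*x*B) - 4*((k:ℝ)+1)^2 * F := by
    have hk2 : ((k:ℝ)+2) ≠ 0 := by positivity
    apply mul_left_cancel₀ hk2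
    linear_combination ((2*(k:ℝ)+3)) * f1 - (k+1) * f2
  rw [hA]
  simp only [Nat.factorial_succ, pow_succ]
  have hf : (k.factorial : ℝ) ≠ 0 := by positivity
  push_cast
  field_simp
  ring

theorem legAux_ge_one (k : ℕ) (x : ℝ) (hx : 1 ≤ x) : 1 ≤ legP k x ∧ legP k x ≤ legP (k+1) x := by
  induction k with
  | zero => simp [legAux_zero, legAux_one, hx]
  | succ k ih =>
    refine ⟨ih.1.trans ih.2, ?_⟩
    have h := legAux_rec k x
    have hk : (0:ℝ) ≤ k := by positivity
    have h1 : legP (k+1) x ≤ x * legP (k+1) x := by nlinarith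
    have h2 : (2*(k:ℝ)+3) * legP (k+1) x ≤ (2*k+3) * (x * legP (k+1) x) := by gcongr
    have h3 : ((k:ℝ)+1) * legP k x ≤ (k+1) * legP (k+1) x := by gcongr; exact ih.2
    have h4 : ((k:ℝ)+2) * legP (k+1) x ≤ (k+2) * legP (k+2) x := by linarith
    exact le_of_mul_le_mul_left h4 (by positivity)

theorem legAux_closure (k : ℕ) (y : ℝ) (h : ∀ t, y < t → 0 < legP k t) : 0 ≤ legP k y := by
  have h1 : Tendsto (legP k) (nhdsWithin y (Set.Ioi y)) (nhds (legP k y)) :=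
    ((legAux_cont k).tendsto y).mono_left nhdsWithin_le_nhds
  refine ge_of_tendsto h1 ?_
  filter_upwards [self_mem_nhdsWithin] with t ht
  exact (h t ht).le

theorem legAux_down (k : ℕ) : ∀ y : ℝ, (∀ t, y < t → 0 < legP (k+1) t) →
    ∀ t, y < t → 0 < legP k t := by
  induction k with
  | zero => intro y _ t _; simp [legAux_zero]
  | succ k ih =>
    intro y hy t ht
    by_contra hneg
    push Not at hneg
    set S := {s : ℝ | t ≤ s ∧ legP (k+1) s ≤ 0} with hS
    have hne : S.Nonempty := ⟨t, le_rfl, hneg⟩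
    have hb : BddAbove S := by
      refine ⟨1, fun s hs => ?_⟩
      by_contra h
      push Not at h
      have := (legAux_ge_one (k+1) s h.le).1
      linarith [hs.2]
    have hcl : IsClosed S :=
      (isClosed_le continuous_const continuous_id).inter
        (isClosed_le (legAux_cont (k+1)) continuous_const)
    obtain ⟨hw1, hw2⟩ := hcl.csSup_mem hne hb
    have hpos : ∀ s, sSup S < s → 0 < legP (k+1) s := by
      intro s hs
      by_contra h
      push Not at h
      have := le_csSup hb (show s ∈ S from ⟨hw1.trans hs.le, h⟩)
      linarith
    have hw0 : legP (k+1) (sSup S) = 0 := le_antisymm hw2 (legAux_closure _ _ hpos)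
    have hk := legAux_closure k _ (ih _ hpos)
    have hr := legAux_rec k (sSup S)
    have hp := hy (sSup S) (ht.trans_le hw1)
    rw [hw0] at hr
    have h1 : 0 < ((k:ℝ)+2) * legP (k+2) (sSup S) := by positivity
    have h2 : 0 ≤ ((k:ℝ)+1) * legP k (sSup S) := by positivity
    linarith

theorem legAux_mono (n : ℕ) (x : ℝ) (hx : x ≤ 1) (h : ∀ k, k ≤ n → 0 ≤ legP k x) :
    ∀ k, k < n → legP (k+1) x ≤ legP k x := by
  intro k
  induction k with
  | zero => intro _; simp [legAux_zero, legAux_one, hx]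
  | succ k ih =>
    intro hk
    have i := ih (by omega)
    have hp := h (k+1) (by omega)
    have hr := legAux_rec k x
    have h1 : x * legP (k+1) x ≤ legP (k+1) x := by nlinarith
    have h2 : (2*(k:ℝ)+3) * (x * legP (k+1) x) ≤ (2*k+3) * legP (k+1) x := by gcongr
    have h3 : ((k:ℝ)+1) * legP (k+1) x ≤ (k+1) * legP k x := by gcongr
    have h4 : ((k:ℝ)+2) * legP (k+2) x ≤ (k+2) * legP (k+1) x := by linarith
    exact le_of_mul_le_mul_left h4 (by positivity)

/-- For $1 ≤ m ≤ n$ and $x ∈ [z_n, 1]$, where $z_n$ is the largest real zero of $P_n$,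
one has $P_n(x) ≤ P_m(x)$. -/
theorem legP_antitone_on_tail (n : ℕ) (hn : 1 ≤ n) (z : ℝ)
    (hz : IsGreatest {x : ℝ | legP n x = 0} z)
    (m : ℕ) (hm : 1 ≤ m) (hmn : m ≤ n)
    (x : ℝ) (hx : x ∈ Set.Icc z 1) :
    legP n x ≤ legP m x := by
  have hpos : ∀ t, z < t → 0 < legP n t := by
    intro t ht
    by_contra hneg
    push Not at hneg
    have h1 := (legAux_ge_one n (max t 1) (le_max_right _ _)).1
    obtain ⟨s, hs, hs0⟩ := intermediate_value_Icc (le_max_left t 1)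
      (legAux_cont n).continuousOn (show (0:ℝ) ∈ Set.Icc _ _ from ⟨hneg, by linarith⟩)
    have := hz.2 hs0
    linarith [hs.1]
  have hall : ∀ k, k ≤ n → ∀ t, z < t → 0 < legP k t := by
    intro k hk
    exact Nat.decreasingInduction (motive := fun k _ => ∀ t, z < t → 0 < legP k t)
      (fun k _ ih => legAux_down k z ih) hpos hk
  have hnn : ∀ k, k ≤ n → 0 ≤ legP k x := fun k hk =>
    legAux_closure k x fun t ht => hall k hk t (hx.1.trans_lt ht)
  exact Nat.decreasingInduction (motive := fun k _ => legP n x ≤ legP k x)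
      (fun k hk ih => ih.trans (legAux_mono n x hx.2 hnn k hk)) le_rfl hmn
end

section
/- For every integer n ≥ 1, the largest real zero z_n of the n-th Legendre polynomial P_n satisfies z_n ≤ 1 − 2/(n(n+1)). -/
open MeasureTheory Filter

open Polynomial in
theorem aux_single (p : ℝ[X]) (hp : p.Splits) (x y : ℝ) (hx : p.eval x ≠ 0)
    (hr : ∀ z ∈ p.roots, z ≤ x) (hy : y ∈ p.roots) :
    0 < x - y ∧ 1 / (x - y) ≤ p.derivative.eval x / p.eval x := by
  have hlt : ∀ z ∈ p.roots, 0 < x - z := by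
    intro z hz
    have h1 := hr z hz
    have h2 : z ≠ x := by
      rintro rfl
      exact hx (isRoot_of_mem_roots hz)
    exact sub_pos.2 (lt_of_le_of_ne h1 h2)
  refine ⟨hlt y hy, ?_⟩
  rw [hp.eval_derivative_div_eval_of_ne_zero hx]
  apply Multiset.single_le_sum
  · intro w hw
    obtain ⟨z, hz, rfl⟩ := Multiset.mem_map.1 hw
    exact (one_div_pos.2 (hlt z hz)).le
  · exact Multiset.mem_map.2 ⟨y, hy, rfl⟩

open Polynomial in
theorem aux_deriv (p : ℝ[X]) (hp : p.Splits) (hr : ∀ z ∈ p.roots, z ≤ 1) :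
    p.derivative.Splits ∧ ∀ z ∈ p.derivative.roots, z ≤ 1 := by
  constructor
  · rw [splits_iff_card_roots] at hp ⊢
    have h1 := p.card_roots_le_derivative
    have h2 := p.natDegree_derivative_le
    have h3 := p.derivative.card_roots'
    omega
  · intro x hx
    by_contra! hlt
    have h0 : p ≠ 0 := by
      rintro rfl
      simp at hx
    have hpx : p.eval x ≠ 0 := by
      intro h
      have := hr x ((mem_roots h0).2 h)
      linarith
    have hd : p.derivative.eval x = 0 := isRoot_of_mem_roots hx
    by_cases he : p.roots = 0
    · rw [splits_iff_card_roots, he] at hp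
      have h := natDegree_eq_zero.1 hp.symm
      obtain ⟨c, rfl⟩ := h
      simp at hx
    · obtain ⟨y, hy⟩ := Multiset.exists_mem_of_ne_zero he
      obtain ⟨h1, h2⟩ := aux_single p hp x y hpx (fun z hz => (hr z hz).trans hlt.le) hy
      rw [hd, zero_div] at h2
      have := one_div_pos.2 h1
      linarith

open Polynomial in
theorem aux_iter (p : ℝ[X]) (hp : p.Splits) (hr : ∀ z ∈ p.roots, z ≤ 1) (k : ℕ) :
    (derivative^[k] p).Splits ∧ ∀ z ∈ (derivative^[k] p).roots, z ≤ 1 := by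
  induction k with
  | zero => exact ⟨hp, hr⟩
  | succ k ih =>
    rw [Function.iterate_succ_apply']
    exact aux_deriv _ ih.1 ih.2

open Polynomial in
theorem aux_iterDeriv (p : ℝ[X]) (k : ℕ) :
    iteratedDeriv k (fun y => p.eval y) = fun y => (derivative^[k] p).eval y := by
  induction k with
  | zero => simp
  | succ k ih =>
    rw [iteratedDeriv_succ, ih, Function.iterate_succ_apply']
    funext y
    exact Polynomial.deriv _

open Polynomial in
theorem aux_eval (p : ℝ[X]) (k : ℕ) (x : ℝ) :
    (derivative^[k] p).eval x = k.factorial * (taylor x p).coeff k := by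
  rw [taylor_coeff, ← factorial_smul_hasseDeriv]
  simp

open Polynomial in
theorem aux_taylor (n : ℕ) :
    taylor (1:ℝ) ((X ^ 2 - 1 : ℝ[X]) ^ n) = (X + C 2) ^ n * X ^ n := by
  rw [taylor_pow, ← mul_pow]
  congr 1
  simp only [taylor_apply, sub_comp, pow_comp, X_comp, one_comp, C_1]
  have : (C 2 : ℝ[X]) = 2 := map_ofNat C 2
  rw [this]
  ring

open Polynomial in
/-- The largest real zero $z_n$ of $P_n$ satisfies $z_n ≤ 1 - 2/(n(n+1))$. -/
theorem greatest_zero_le (n : ℕ) (hn : 1 ≤ n) (z : ℝ)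
    (hz : IsGreatest {x : ℝ | legP n x = 0} z) :
    z ≤ 1 - 2 / ((n : ℝ) * ((n : ℝ) + 1)) := by
  set p : ℝ[X] := (X ^ 2 - 1) ^ n with hpdef
  have hf : (fun y : ℝ => (y ^ 2 - 1) ^ n) = fun y => p.eval y := by
    funext y; simp [hpdef]
  have hz0 : (derivative^[n] p).eval z = 0 := by
    have h : legP n z = 0 := hz.1
    unfold legP at h
    rw [hf, aux_iterDeriv] at h
    rcases mul_eq_zero.1 h with h | h
    · have : (0:ℝ) < 1 / ((2 : ℝ) ^ n * (n.factorial : ℝ)) := by positivity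
      exact absurd h this.ne'
    · exact h
  have hps : p.Splits := by
    have : p = ((X - C 1) * (X + C 1)) ^ n := by
      rw [hpdef, C_1]; congr 1; ring
    rw [this]
    exact ((Splits.X_sub_C _).mul (Splits.X_add_C _)).pow n
  have hpr : ∀ x ∈ p.roots, x ≤ 1 := by
    intro x hx
    have h : p.eval x = 0 := isRoot_of_mem_roots hx
    simp only [hpdef, eval_pow, eval_sub, eval_X, eval_one] at h
    have h := eq_zero_of_pow_eq_zero h
    nlinarith
  obtain ⟨hs, hr⟩ := aux_iter p hps hpr n
  have e1 : (derivative^[n] p).eval 1 = n.factorial * 2 ^ n := by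
    rw [aux_eval, hpdef, aux_taylor, coeff_mul_X_pow', coeff_X_add_C_pow]
    simp
  have e2 : (derivative^[n] p).derivative.eval 1
      = (n + 1) * n.factorial * (2 ^ (n - 1) * n) := by
    rw [← Function.iterate_succ_apply' (f := ⇑(derivative (R := ℝ))), aux_eval, hpdef, aux_taylor,
      coeff_mul_X_pow', coeff_X_add_C_pow]
    simp [Nat.factorial_succ]
  have hne : (derivative^[n] p).eval 1 ≠ 0 := by
    rw [e1]; positivity
  have hq0 : derivative^[n] p ≠ 0 := by
    intro h; rw [h] at hne; simp at hne
  obtain ⟨h1, h2⟩ := aux_single _ hs 1 z hne hr ((mem_roots hq0).2 hz0)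
  have hn0 : (0:ℝ) < n := by exact_mod_cast hn
  have e3 : (derivative^[n] p).derivative.eval 1 / (derivative^[n] p).eval 1
      = n * (n + 1) / 2 := by
    rw [e1, e2]
    obtain ⟨m, rfl⟩ := Nat.exists_eq_add_of_le' hn
    have : ((m+1).factorial : ℝ) ≠ 0 := by positivity
    rw [Nat.add_sub_cancel, pow_succ]
    field_simp
  rw [e3, div_le_iff₀ h1] at h2
  have : 2 / ((n : ℝ) * (n + 1)) ≤ 1 - z := by
    rw [div_le_iff₀ (by positivity)]
    linarith
  linarith
end

section
/- For every integer n ≥ 1 and every real x with 1 − 2/(n(n+1)) ≤ x ≤ 1, one has P_n(x) ≥ (n(n+1)/2)·x − n(n+1)/2 + 1; that is, on this interval P_n lies above the line through (1,1) with slope n(n+1)/2. -/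
open MeasureTheory Filter

open Polynomial in
lemma aux_iter_s4 (p : ℝ[X]) (k : ℕ) :
    iteratedDeriv k (fun y : ℝ => p.eval ((1 - y) / 2)) =
      fun y => (-1 / 2 : ℝ) ^ k * (derivative^[k] p).eval ((1 - y) / 2) := by
  induction k with
  | zero => simp
  | succ k ih =>
    rw [iteratedDeriv_succ, ih]
    funext y
    have h1 : HasDerivAt (fun y : ℝ => (1 - y) / 2) (-1 / 2) y :=
      ((hasDerivAt_id y).const_sub 1).div_const 2
    have h2 := (((derivative^[k] p).hasDerivAt ((1 - y) / 2)).comp y h1).const_mul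
      ((-1 / 2 : ℝ) ^ k)
    have h3 := h2.deriv
    simp only [Function.comp_def] at h3
    rw [h3, Function.iterate_succ_apply']
    ring

lemma aux_alt (m : ℕ) : ∀ c : ℕ → ℝ, (∀ k, 0 ≤ c k) → (∀ k, c (k + 1) ≤ c k) →
    0 ≤ ∑ k ∈ Finset.range m, (-1 : ℝ) ^ k * c k ∧
      ∑ k ∈ Finset.range m, (-1 : ℝ) ^ k * c k ≤ c 0 := by
  induction m with
  | zero => intro c h0 _; simpa using h0 0
  | succ m ih =>
    intro c h0 h1
    obtain ⟨ha, hb⟩ := ih (fun k => c (k + 1)) (fun k => h0 _) (fun k => h1 _)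
    rw [Finset.sum_range_succ']
    have : ∑ k ∈ Finset.range m, (-1 : ℝ) ^ (k + 1) * c (k + 1) =
        - ∑ k ∈ Finset.range m, (-1 : ℝ) ^ k * c (k + 1) := by
      rw [← Finset.sum_neg_distrib]
      exact Finset.sum_congr rfl fun k _ => by ring
    rw [this]
    have := h1 0
    simp only [zero_add] at *
    constructor <;> linarith

open Polynomial in
lemma aux_legP (n : ℕ) (x : ℝ) : legP n x =
    ∑ k ∈ Finset.range (n + 1), (-1 : ℝ) ^ k *
      ((n.choose k : ℝ) * ((n + k).choose n : ℝ) * ((1 - x) / 2) ^ k) := by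
  have hf : (fun y : ℝ => (y ^ 2 - 1) ^ n) = fun y : ℝ =>
      (C ((-4 : ℝ) ^ n) * (X ^ n * (1 - X) ^ n) : ℝ[X]).eval ((1 - y) / 2) := by
    funext y
    simp only [eval_mul, eval_C, eval_pow, eval_X, eval_sub, eval_one, ← mul_pow]
    congr 1
    ring
  have hs := congrArg (Polynomial.map (Int.castRingHom ℝ)) (factorial_mul_shiftedLegendre_eq n)
  rw [← Polynomial.iterate_derivative_map] at hs
  simp only [Polynomial.map_mul, Polynomial.map_pow, Polynomial.map_sub, Polynomial.map_one,
    Polynomial.map_X, Polynomial.map_natCast] at hs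
  unfold legP
  rw [hf, aux_iter_s4]
  simp only [iterate_derivative_C_mul, ← hs, eval_mul, eval_C, eval_natCast]
  have he : ((shiftedLegendre n).map (Int.castRingHom ℝ)).eval ((1 - x) / 2) =
    ∑ k ∈ Finset.range (n + 1), (-1 : ℝ) ^ k *
      ((n.choose k : ℝ) * ((n + k).choose n : ℝ) * ((1 - x) / 2) ^ k) := by
    simp [shiftedLegendre, Polynomial.map_sum, eval_finset_sum, mul_assoc]
  rw [he]
  have h2 : (-1 / 2 : ℝ) ^ n * (-4) ^ n = 2 ^ n := by
    rw [← mul_pow]; norm_num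
  have hfac : (n.factorial : ℝ) ≠ 0 := by positivity
  rw [← mul_assoc ((-1 / 2 : ℝ) ^ n), h2]
  field_simp

lemma aux_step (n k : ℕ) (t : ℝ) (h0 : 0 ≤ t) (h1 : t * ((n : ℝ) * (n + 1)) ≤ 1) :
    (n.choose (k+1) : ℝ) * ((n + (k+1)).choose n : ℝ) * t ^ (k+1) ≤
      (n.choose k : ℝ) * ((n + k).choose n : ℝ) * t ^ k := by
  have e1 : (n.choose (k+1) : ℝ) * (k + 1) = n.choose k * ((n : ℝ) - k) := by
    rcases le_or_gt k n with h | h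
    · have := Nat.choose_succ_right_eq n k
      rw [← Nat.cast_sub h]; exact_mod_cast this
    · simp [Nat.choose_eq_zero_of_lt h, Nat.choose_eq_zero_of_lt (Nat.lt_succ_of_lt h)]
  have e2 : ((n + (k+1)).choose n : ℝ) * (k + 1) = (n + k).choose n * ((n : ℝ) + k + 1) := by
    have := Nat.choose_mul_succ_eq (n + k) n
    have h3 : n + k + 1 - n = k + 1 := by omega
    rw [h3] at this
    rw [← add_assoc]
    exact_mod_cast this.symm
  set A := (n.choose k : ℝ)
  set B := ((n + k).choose n : ℝ)
  have hA : 0 ≤ A := by positivity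
  have hB : 0 ≤ B := by positivity
  have hk : (0 : ℝ) ≤ k := by positivity
  have key : ((n : ℝ) - k) * (n + k + 1) * t ≤ (k + 1) * (k + 1) := by
    nlinarith [mul_nonneg hk h0, mul_nonneg hk hk, mul_nonneg (mul_nonneg hk hk) h0]
  have hp : (0 : ℝ) < (k + 1) * (k + 1) := by positivity
  refine le_of_mul_le_mul_right ?_ hp
  calc _ = ((n.choose (k+1) : ℝ) * (k + 1)) * (((n + (k+1)).choose n : ℝ) * (k + 1)) *
        (t ^ k * t) := by ring
    _ = (A * B * t ^ k) * (((n : ℝ) - k) * (n + k + 1) * t) := by rw [e1, e2]; ring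
    _ ≤ _ := mul_le_mul_of_nonneg_left key (by positivity)

/-- On $[1 - 2/(n(n+1)), 1]$, the polynomial $P_n$ lies above the line through $(1,1)$
with slope $n(n+1)/2$. -/
theorem legP_ge_line (n : ℕ) (hn : 1 ≤ n) (x : ℝ)
    (hx : x ∈ Set.Icc (1 - 2 / ((n : ℝ) * ((n : ℝ) + 1))) 1) :
    ((n : ℝ) * ((n : ℝ) + 1) / 2) * x - (n : ℝ) * ((n : ℝ) + 1) / 2 + 1 ≤ legP n x := by
  obtain ⟨hx1, hx2⟩ := hx
  have hnp : (0 : ℝ) < n := by exact_mod_cast hn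
  have hN : (0 : ℝ) < (n : ℝ) * (n + 1) := by positivity
  have h0 : 0 ≤ (1 - x) / 2 := by linarith
  have h1 : (1 - x) / 2 * ((n : ℝ) * (n + 1)) ≤ 1 := by
    rw [← le_div_iff₀ hN]
    have : 2 / ((n : ℝ) * (n + 1)) = 2 * (1 / ((n : ℝ) * (n + 1))) := by ring
    linarith
  rw [aux_legP]
  obtain ⟨m, rfl⟩ : ∃ m, n = m + 1 := ⟨n - 1, by omega⟩
  rw [Finset.sum_range_succ', Finset.sum_range_succ']
  have := (aux_alt m (fun k => ((m+1).choose (k+2) : ℝ) * ((m + 1 + (k+2)).choose (m+1) : ℝ) *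
    ((1 - x) / 2) ^ (k+2)) (fun k => by positivity) (fun k => aux_step _ (k+2) _ h0 h1)).1
  have h3 : ∀ k, (-1 : ℝ) ^ (k + 1 + 1) = (-1) ^ k := fun k => by ring
  have h4 : (m + 1 + 1).choose (m + 1) = m + 2 := by
    rw [Nat.choose_succ_self_right]
  simp only [h3]
  simp [h4] 
  push_cast at *
  linarith
end

section
/- For every integer n ≥ 1 and every real p > 0, ∫_{z_n}^{1} P_n(x)^p dx ≥ 2/((p+1)·n·(n+1)). -/
open MeasureTheory Filter

open Polynomial in
theorem aux_splits (f : ℝ[X]) (hf : f.Splits) : (derivative f).Splits := by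
  rw [splits_iff_card_roots] at hf ⊢
  have h1 := card_roots_le_derivative f
  have h2 := natDegree_derivative_le f
  have h3 := card_roots' (derivative f)
  rcases Nat.eq_zero_or_pos f.natDegree with h | h
  · have : derivative f = 0 := derivative_of_natDegree_zero h
    simp [this]
  · omega

open Polynomial in
theorem aux_splits_iter (f : ℝ[X]) (hf : f.Splits) (k : ℕ) : (derivative^[k] f).Splits := by
  induction k with
  | zero => simpa using hf
  | succ k ih => rw [Function.iterate_succ_apply']; exact aux_splits _ ih

open Polynomial in
def NN (z : ℝ) (f : ℝ[X]) : Prop := ∀ (k : ℕ) (x : ℝ), z ≤ x → 0 ≤ (derivative^[k] f).eval x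

open Polynomial in
theorem NN_mul {z : ℝ} {f g : ℝ[X]} (hf : NN z f) (hg : NN z g) : NN z (f * g) := by
  intro k x hx
  rw [iterate_derivative_mul, eval_finset_sum]
  refine Finset.sum_nonneg fun i _ => ?_
  rw [eval_smul, eval_mul]
  exact nsmul_nonneg (mul_nonneg (hf _ _ hx) (hg _ _ hx)) _

open Polynomial in
theorem NN_C {z a : ℝ} (ha : 0 ≤ a) : NN z (C a) := by
  intro k x hx
  rcases Nat.eq_zero_or_pos k with h | h
  · subst h; simpa using ha
  · rw [iterate_derivative_C h]; simp

open Polynomial in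
theorem NN_X_sub {z r : ℝ} (hr : r ≤ z) : NN z (X - C r) := by
  intro k x hx
  rcases k with _ | _ | k
  · simp; linarith
  · simp
  · simp

open Polynomial in
theorem NN_pow {z : ℝ} {f : ℝ[X]} (hf : NN z f) (n : ℕ) : NN z (f ^ n) := by
  induction n with
  | zero => rw [pow_zero, ← C_1]; exact NN_C zero_le_one
  | succ n ih => rw [pow_succ]; exact NN_mul ih hf

open Polynomial in
theorem NN_prod {z : ℝ} (s : Multiset ℝ) (hs : ∀ r ∈ s, r ≤ z) :
    NN z (s.map (fun a => X - C a)).prod := by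
  induction s using Multiset.induction_on with
  | empty => simp only [Multiset.map_zero, Multiset.prod_zero, ← C_1]; exact NN_C zero_le_one
  | cons a s ih =>
    rw [Multiset.map_cons, Multiset.prod_cons]
    exact NN_mul (NN_X_sub (hs a (by simp))) (ih fun r hr => hs r (by simp [hr]))

open Polynomial in
theorem NN_splits {z : ℝ} (f : ℝ[X]) (hf : f.Splits) (hr : ∀ r ∈ f.roots, r ≤ z) (hz : z ≤ 1)
    (h1 : 0 < f.eval 1) : NN z f := by
  have hp := hf.eq_prod_roots
  have hN := NN_prod f.roots hr
  rcases le_total 0 f.leadingCoeff with h | h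
  · rw [hp]; exact NN_mul (NN_C h) hN
  · have := hN 0 1 hz
    rw [hp, eval_mul, eval_C] at h1
    simp only [Function.iterate_zero, id] at this
    nlinarith [mul_nonneg (neg_nonneg.2 h) this]

open Polynomial in
theorem eval_iter_one (n k : ℕ) : (derivative^[k] ((X ^ 2 - 1 : ℝ[X]) ^ n)).eval 1 =
    k.factorial * (X ^ n * (X + C 2) ^ n : ℝ[X]).coeff k := by
  have h : taylor (1:ℝ) ((X ^ 2 - 1 : ℝ[X]) ^ n) = X ^ n * (X + C 2) ^ n := by
    rw [← mul_pow, taylor_pow]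
    congr 1
    simp only [map_sub, taylor_pow, taylor_X, taylor_one]
    have : (C 2 : ℝ[X]) = 2 := rfl
    rw [this]; simp only [map_one]; ring
  rw [← h, taylor_coeff, ← factorial_smul_hasseDeriv]
  simp

open Polynomial in
theorem legP_eq_s5 (n : ℕ) (x : ℝ) : legP n x = (1 / ((2 : ℝ) ^ n * (n.factorial : ℝ))) *
    (derivative^[n] ((X ^ 2 - 1 : ℝ[X]) ^ n)).eval x := by
  unfold legP
  congr 1
  have : ∀ (k : ℕ) (f : ℝ[X]), iteratedDeriv k (fun y => f.eval y) =
      fun y => (derivative^[k] f).eval y := by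
    intro k
    induction k with
    | zero => intro f; simp
    | succ k ih =>
      intro f
      rw [iteratedDeriv_succ, ih, Function.iterate_succ_apply']
      ext y; simp
  have h := congrFun (this n ((X ^ 2 - 1 : ℝ[X]) ^ n)) x
  simpa using h

open Polynomial in
theorem poly_mono (f : ℝ[X]) (a b : ℝ) (hab : a ≤ b)
    (h : ∀ x, a ≤ x → 0 ≤ (derivative f).eval x) : f.eval a ≤ f.eval b := by
  have := monotoneOn_of_deriv_nonneg (convex_Ici a) f.continuousOn
    f.differentiable.differentiableOn (fun x hx => by
      rw [interior_Ici] at hx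
      rw [Polynomial.deriv]; exact h x (le_of_lt hx))
  exact this (Set.mem_Ici.2 le_rfl) (Set.mem_Ici.2 hab) hab

open Polynomial in
theorem main_poly (n : ℕ) (hn : 1 ≤ n) (z : ℝ) (hz : IsGreatest {x : ℝ | legP n x = 0} z) :
    z ≤ 1 ∧ (∀ x, z ≤ x → 0 ≤ legP n x) ∧ Continuous (legP n) ∧
    (∀ x, z ≤ x → x ≤ 1 → 1 - (n * (n + 1) / 2 : ℝ) * (1 - x) ≤ legP n x) := by
  set c : ℝ := 1 / ((2 : ℝ) ^ n * (n.factorial : ℝ)) with hc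
  have hc0 : 0 < c := by positivity
  set g : ℝ[X] := (X ^ 2 - 1) ^ n with hg
  set F : ℝ[X] := C c * derivative^[n] g with hF
  have hL : legP n = fun x => F.eval x := by
    ext x; rw [legP_eq_s5, hF, eval_mul, eval_C]
  have hfac : (X ^ 2 - 1 : ℝ[X]) = (X - C 1) * (X - C (-1)) := by
    simp only [map_neg, map_one]; ring
  have hF1 : F.eval 1 = 1 := by
    rw [hF, eval_mul, eval_C, hg, eval_iter_one, hc]
    have : (X ^ n * (X + C 2) ^ n : ℝ[X]).coeff n = 2 ^ n := by
      have := coeff_X_pow_mul ((X + C 2) ^ n : ℝ[X]) n 0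
      rw [zero_add] at this
      rw [this, coeff_X_add_C_pow]; simp
    rw [this]; field_simp
  have hF'1 : (derivative F).eval 1 = n * (n + 1) / 2 := by
    rw [hF, derivative_C_mul, eval_mul, eval_C, ← Function.iterate_succ_apply' derivative,
      hg, eval_iter_one, hc]
    have : (X ^ n * (X + C 2) ^ n : ℝ[X]).coeff (n + 1) = 2 ^ (n - 1) * n := by
      have := coeff_X_pow_mul ((X + C 2) ^ n : ℝ[X]) n 1
      rw [add_comm n 1, this, coeff_X_add_C_pow]; simp
    rw [Nat.succ_eq_add_one, this, Nat.factorial_succ]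
    obtain ⟨m, rfl⟩ : ∃ m, n = m + 1 := ⟨n - 1, by omega⟩
    rw [Nat.add_sub_cancel]
    push_cast
    field_simp
    ring
  have hgN : NN 1 g := by
    rw [hg, hfac]
    exact NN_pow (NN_mul (NN_X_sub le_rfl) (NN_X_sub (by norm_num))) n
  have hz0 : F.eval z = 0 := by have := hz.1; rw [hL] at this; exact this
  have hz1 : z ≤ 1 := by
    by_contra hcon
    push Not at hcon
    have := poly_mono F 1 z hcon.le (fun x hx => by
      rw [hF, derivative_C_mul, eval_mul, eval_C, ← Function.iterate_succ_apply' derivative]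
      exact mul_nonneg hc0.le (hgN _ _ hx))
    linarith
  have hsp : F.Splits := by
    rw [hF]
    refine (Splits.C c).mul (aux_splits_iter _ ?_ _)
    rw [hg, hfac]
    exact ((Splits.X_sub_C 1).mul (Splits.X_sub_C (-1))).pow n
  have hN : NN z F := by
    refine NN_splits F hsp (fun r hr => ?_) hz1 (by rw [hF1]; exact one_pos)
    apply hz.2
    rw [hL]
    exact (mem_roots'.1 hr).2
  refine ⟨hz1, fun x hx => by rw [hL]; exact hN 0 x hx, by rw [hL]; exact F.continuous, ?_⟩
  intro x hx hx1
  rw [hL]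
  -- slope bound
  have hd : ∀ y, z ≤ y → y ≤ 1 → (derivative F).eval y ≤ n * (n + 1) / 2 := by
    intro y hy hy1
    rw [← hF'1]
    exact poly_mono _ y 1 hy1 (fun w hw => hN 2 w (hy.trans hw))
  have := (convex_Icc x 1).image_sub_le_mul_sub_of_deriv_le (f := fun y => F.eval y)
    F.continuousOn F.differentiable.differentiableOn (C := n * (n + 1) / 2) (fun y hy => by
      rw [interior_Icc] at hy
      rw [Polynomial.deriv]; exact hd y (hx.trans hy.1.le) hy.2.le) x ⟨le_rfl, hx1⟩ 1
      ⟨hx1, le_rfl⟩ hx1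
  simp only [hF1] at this
  show _ ≤ F.eval x
  linarith

/-- For $n ≥ 1$ and $p > 0$, $∫_{z_n}^1 P_n(x)^p\,dx ≥ 2/((p+1)n(n+1))$, where
$z_n$ is the largest real zero of $P_n$. -/
theorem integral_legP_rpow_ge (n : ℕ) (hn : 1 ≤ n) (z : ℝ)
    (hz : IsGreatest {x : ℝ | legP n x = 0} z)
    (p : ℝ) (hp : 0 < p) :
    2 / ((p + 1) * (n : ℝ) * ((n : ℝ) + 1)) ≤ ∫ x in z..1, (legP n x) ^ p := by
  obtain ⟨hz1, hpos, hcont, htan⟩ := main_poly n hn z hz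
  have hn0 : (0 : ℝ) < n := by exact_mod_cast hn
  set K : ℝ := n * (n + 1) / 2 with hK
  have hK0 : 0 < K := by positivity
  set a : ℝ := 1 - 1 / K with ha
  have hza : z ≤ a := by
    have h := htan z le_rfl hz1
    have h0 : legP n z = 0 := hz.1
    rw [h0] at h
    have : 1 / K ≤ 1 - z := by rw [div_le_iff₀ hK0]; linarith
    linarith
  have ha1 : a ≤ 1 := by have : 0 < 1 / K := by positivity
                         linarith
  have hc1 : Continuous fun x => (legP n x) ^ p := hcont.rpow_const fun x => Or.inr hp.le
  have hKa : K * a = K - 1 := by rw [ha]; field_simp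
  have hc2 : Continuous fun x : ℝ => (K * x + (1 - K)) ^ p :=
    (by fun_prop : Continuous fun x : ℝ => K * x + (1 - K)).rpow_const fun x => Or.inr hp.le
  have e1 : ∫ x in a..1, (K * x + (1 - K)) ^ p = 2 / ((p + 1) * (n : ℝ) * ((n : ℝ) + 1)) := by
    rw [intervalIntegral.integral_comp_mul_add (fun x => x ^ p) hK0.ne', integral_rpow
      (Or.inl (by linarith))]
    have h1 : K * a + (1 - K) = 0 := by linarith
    have h2 : K * 1 + (1 - K) = 1 := by ring
    rw [h1, h2, Real.one_rpow, Real.zero_rpow (by linarith), hK, smul_eq_mul]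
    field_simp
    ring
  rw [← e1, ← intervalIntegral.integral_add_adjacent_intervals (hc1.intervalIntegrable z a)
    (hc1.intervalIntegrable a 1)]
  have i1 : 0 ≤ ∫ x in z..a, (legP n x) ^ p :=
    intervalIntegral.integral_nonneg hza fun x hx => Real.rpow_nonneg (hpos x hx.1) p
  have i2 : ∫ x in a..1, (K * x + (1 - K)) ^ p ≤ ∫ x in a..1, (legP n x) ^ p := by
    refine intervalIntegral.integral_mono_on ha1 (hc2.intervalIntegrable _ _)
      (hc1.intervalIntegrable _ _) fun x hx => ?_
    have := mul_le_mul_of_nonneg_left hx.1 hK0.le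
    refine Real.rpow_le_rpow (by linarith) ?_ hp.le
    have := htan x (hza.trans hx.1) hx.2
    linarith
  linarith
end

section
/- For every real p > 4, liminf_{n→∞} (∫₀¹ P_{4n,+}(x)^p dx) / (∫₀¹ P_{4n,-}(x)^p dx) ≥ (1/(p+1)) · (2/(3π²)) · (Σ_{i=1}^{∞} i · |J₀(j_{2i−1})|^p)^{−1}. -/
open MeasureTheory Filter

/-- The Bessel function of the first kind of order 0. -/
noncomputable def besselJ0 (x : ℝ) : ℝ :=
  ∑' k : ℕ, (-1 : ℝ) ^ k * (x / 2) ^ (2 * k) / ((k.factorial : ℝ)) ^ 2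

/-- The Bessel function of the first kind of order 1. -/
noncomputable def besselJ1 (x : ℝ) : ℝ :=
  ∑' k : ℕ, (-1 : ℝ) ^ k * (x / 2) ^ (2 * k + 1) /
    ((k.factorial : ℝ) * ((k + 1).factorial : ℝ))

namespace LegAux
open Polynomial

lemma iteratedDeriv_poly (Q : ℝ[X]) (n : ℕ) :
    iteratedDeriv n (fun y => Q.eval y) = fun y => (derivative^[n] Q).eval y := by
  induction n with
  | zero => simp
  | succ n ih =>
    rw [iteratedDeriv_succ, ih, Function.iterate_succ_apply']
    funext y
    exact Polynomial.deriv _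

/-- real shifted Legendre polynomial -/
noncomputable def LR (N : ℕ) : ℝ[X] := (shiftedLegendre N).map (Int.castRingHom ℝ)

lemma iterate_derivative_comp_lin (Q : ℝ[X]) (n : ℕ) :
    derivative^[n] (Q.comp (1 - 2 * X)) = C ((-2 : ℝ) ^ n) * (derivative^[n] Q).comp (1 - 2 * X) := by
  induction n with
  | zero => simp
  | succ n ih =>
    rw [Function.iterate_succ_apply', ih, Function.iterate_succ_apply', derivative_C_mul,
      derivative_comp]
    have : derivative (1 - 2 * X : ℝ[X]) = C (-2) := by
      rw [show (2 : ℝ[X]) = C 2 from rfl]; simp [derivative_mul]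
    rw [this, pow_succ, C_mul]
    ring

lemma legP_eval (N : ℕ) (x : ℝ) :
    legP N x = (1 / ((2 : ℝ) ^ N * (N.factorial : ℝ))) *
      (derivative^[N] ((X ^ 2 - 1 : ℝ[X]) ^ N)).eval x := by
  unfold legP
  have := congrFun (iteratedDeriv_poly ((X ^ 2 - 1 : ℝ[X]) ^ N) N) x
  rw [← this]
  simp

lemma rodr (N : ℕ) : (N.factorial : ℝ[X]) * LR N =
    derivative^[N] (X ^ N * (1 - (X : ℝ[X])) ^ N) := by
  have h := congrArg (Polynomial.map (Int.castRingHom ℝ)) (factorial_mul_shiftedLegendre_eq N)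
  rw [← iterate_derivative_map] at h
  simpa [LR] using h

lemma legP_eq (N : ℕ) (y : ℝ) : legP N (1 - 2 * y) = (LR N).eval y := by
  rw [legP_eval]
  have h1 := iterate_derivative_comp_lin ((X ^ 2 - 1 : ℝ[X]) ^ N) N
  have h2 : ((X ^ 2 - 1 : ℝ[X]) ^ N).comp (1 - 2 * X) =
      C ((-4 : ℝ) ^ N) * (X ^ N * (1 - (X : ℝ[X])) ^ N) := by
    simp only [pow_comp, sub_comp, X_comp, one_comp]
    rw [← mul_pow, C_pow, ← mul_pow]
    congr 1
    rw [show (2 : ℝ[X]) = C 2 from rfl]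
    rw [show (C (-4) : ℝ[X]) = -4 from by rw [C_neg]; rfl]
    rw [show (C 2 : ℝ[X]) = 2 from rfl]
    ring
  rw [h2, iterate_derivative_C_mul, ← rodr] at h1
  have h3 := congrArg (Polynomial.eval y) h1
  simp only [eval_mul, eval_C, eval_comp, eval_sub, eval_one, eval_X, eval_natCast, eval_ofNat] at h3
  have hf : (N.factorial : ℝ) ≠ 0 := by positivity
  have h4 : ((-4 : ℝ)) ^ N = (-2) ^ N * 2 ^ N := by rw [← mul_pow]; norm_num
  have h5 : ((-2 : ℝ)) ^ N ≠ 0 := by simp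
  rw [h4, mul_assoc] at h3
  have h6 := mul_left_cancel₀ h5 h3
  rw [← h6]
  field_simp

lemma LR_coeff (N k : ℕ) : (LR N).coeff k = (-1) ^ k * N.choose k * (N + k).choose N := by
  simp [LR, coeff_shiftedLegendre]

lemma LR_rec (N k : ℕ) : ((k : ℝ) + 1) ^ 2 * (LR N).coeff (k + 1) =
    (k * (k + 1) - N * (N + 1)) * (LR N).coeff k := by
  rw [LR_coeff, LR_coeff]
  have h1 : (N.choose (k + 1) : ℝ) * (k + 1) = N.choose k * (N - k) := by
    rcases le_or_gt k N with h | h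
    · have := Nat.choose_succ_right_eq N k
      have h' := congrArg (Nat.cast : ℕ → ℝ) this
      push_cast [Nat.cast_sub h] at h'
      exact h'
    · rw [Nat.choose_eq_zero_of_lt h, Nat.choose_eq_zero_of_lt (by omega)]; simp
  have h2 : ((N + (k + 1)).choose N : ℝ) * (k + 1) = (N + k).choose N * (N + k + 1) := by
    have := Nat.add_one_mul_choose_eq (N + k) k
    have e1 : (N + k).choose k = (N + k).choose N := by
      rw [Nat.choose_symm_add]
    have e2 : (N + k + 1).choose (k + 1) = (N + (k + 1)).choose N := by
      rw [show N + k + 1 = N + (k + 1) by omega, ← Nat.choose_symm_add]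
    rw [e1, e2] at this
    have h' := congrArg (Nat.cast : ℕ → ℝ) this
    push_cast at h'
    linarith
  have : ((k : ℝ) + 1) ^ 2 * ((-1) ^ (k + 1) * N.choose (k + 1) * (N + (k + 1)).choose N) =
     (-1) ^ (k + 1) * (N.choose (k + 1) * (k + 1)) * ((N + (k + 1)).choose N * (k + 1)) := by ring
  rw [this, h1, h2]
  ring

lemma LR_ode_poly (N : ℕ) : X * (1 - X) * derivative (derivative (LR N)) +
    (1 - 2 * X) * derivative (LR N) + C ((N : ℝ) * (N + 1)) * LR N = 0 := by
  have : X * (1 - X) * derivative (derivative (LR N)) +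
    (1 - 2 * X) * derivative (LR N) + C ((N : ℝ) * (N + 1)) * LR N
    = X * derivative (derivative (LR N)) - X * (X * derivative (derivative (LR N)))
      + derivative (LR N) - C 2 * (X * derivative (LR N)) + C ((N : ℝ) * (N + 1)) * LR N := by
    rw [show (C 2 : ℝ[X]) = 2 from rfl]
    ring
  rw [this]
  ext k
  have hr := LR_rec N k
  generalize hc : (N : ℝ) * (N + 1) = c at *
  clear this hc
  rcases k with _ | _ | k
  · simp [coeff_derivative] at *
    linarith
  · simp [coeff_derivative] at *
    linarith
  · simp [coeff_derivative] at *
    linarith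

lemma LR_ode (N : ℕ) (y : ℝ) : y * (1 - y) * (derivative (derivative (LR N))).eval y +
    (1 - 2 * y) * (derivative (LR N)).eval y + N * (N + 1) * (LR N).eval y = 0 := by
  have := congrArg (Polynomial.eval y) (LR_ode_poly N)
  simpa using this

lemma LR_symm (N : ℕ) (hN : Even N) (y : ℝ) : (LR N).eval (1 - y) = (LR N).eval y := by
  have := shiftedLegendre_eval_symm N y
  rw [hN.neg_one_pow, one_mul] at this
  simp only [LR, eval_map]
  simpa [aeval_def] using this.symm

lemma LR_deriv_half (N : ℕ) (hN : Even N) : (derivative (LR N)).eval (1 / 2) = 0 := by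
  have h1 := (LR N).hasDerivAt (1 / 2)
  have h1' : HasDerivAt (fun x => eval x (LR N)) (eval (1 / 2) (derivative (LR N))) (1 - 1 / 2) := by
    norm_num at h1 ⊢
    exact h1
  have h2 : HasDerivAt (fun y => (LR N).eval (1 - y)) _ (1 / 2) :=
    HasDerivAt.comp (1 / 2 : ℝ) h1' ((hasDerivAt_id' (1 / 2 : ℝ)).const_sub 1)
  simp only [LR_symm N hN] at h2
  have := h1.unique h2
  linarith

lemma central (m : ℕ) : (2 * (m : ℝ) + 1) * (m.centralBinom : ℝ) ^ 2 ≤ 16 ^ m := by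
  induction m with
  | zero => simp
  | succ m ih =>
    have h := congrArg (Nat.cast : ℕ → ℝ) (Nat.succ_mul_centralBinom_succ m)
    push_cast at h ⊢
    have hc : ((m + 1).centralBinom : ℝ) = 2 * (2 * m + 1) * m.centralBinom / (m + 1) := by
      field_simp
      linarith
    rw [hc]
    have : (2 * ((m : ℝ) + 1) + 1) * (2 * (2 * m + 1) * m.centralBinom / (m + 1)) ^ 2
      = ((2 * (m : ℝ) + 1) * (m.centralBinom : ℝ) ^ 2) * (4 * (2 * m + 3) * (2 * m + 1) / (m + 1) ^ 2) := by
      field_simp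
      ring
    rw [this, pow_succ]
    have h2 : (4 * (2 * (m : ℝ) + 3) * (2 * m + 1) / (m + 1) ^ 2) ≤ 16 := by
      rw [div_le_iff₀ (by positivity)]
      nlinarith
    exact mul_le_mul ih h2 (by positivity) (pow_nonneg (by norm_num) _)

lemma LR_half (m : ℕ) : ((LR (2 * m)).eval (1 / 2)) ^ 2 ≤ 1 / (2 * m + 1) := by
  rw [← legP_eq]
  norm_num
  rw [legP_eval]
  rw [← coeff_zero_eq_eval_zero, coeff_iterate_derivative]
  have : ((X ^ 2 - 1 : ℝ[X]) ^ (2 * m)) = expand ℝ 2 ((X + C (-1)) ^ (2 * m)) := by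
    simp [sub_eq_add_neg]
  rw [this, zero_add, mul_comm 2 m, coeff_expand_mul (by norm_num), coeff_X_add_C_pow]
  rw [mul_comm m 2, Nat.descFactorial_self, ← Nat.centralBinom_eq_two_mul_choose]
  have hf : ((2 * m).factorial : ℝ) ≠ 0 := by positivity
  have h := central m
  rw [nsmul_eq_mul]
  have e : (1 / (2 ^ (2 * m) * ((2 * m).factorial : ℝ)) *
      (((2 * m).factorial : ℝ) * ((-1) ^ (2 * m - m) * (m.centralBinom : ℝ)))) ^ 2 =
      (m.centralBinom : ℝ) ^ 2 / 16 ^ m := by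
    have h16 : (16 : ℝ) ^ m = (2 ^ (2 * m)) ^ 2 := by
      rw [← pow_mul, show 2 * m * 2 = 4 * m by ring, pow_mul]; norm_num
    rw [h16]
    have : ((-1 : ℝ) ^ (2 * m - m)) ^ 2 = 1 := by rw [← pow_mul, mul_comm, pow_mul]; simp
    field_simp
    rw [this, one_mul]
  rw [e, inv_eq_one_div, div_le_div_iff₀ (by positivity) (by positivity)]
  linarith

lemma energy (N : ℕ) (hN : Even N) (y : ℝ) (hy : 0 < y) (hy2 : y ≤ 1 / 2) :
    Real.sqrt y * ((LR N).eval y) ^ 2 ≤ ((LR N).eval (1 / 2)) ^ 2 := by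
  set P := fun y : ℝ => (LR N).eval y with hP
  set P' := fun y : ℝ => (derivative (LR N)).eval y with hP'
  set P'' := fun y : ℝ => (derivative (derivative (LR N))).eval y with hP''
  set m : ℝ := (N + 1 / 2) ^ 2 with hm
  set w := fun y : ℝ => 4 * y * (1 - y) with hw
  set D := fun y : ℝ => m * w y + 1 / 4 with hD
  set R := fun y : ℝ => (1 - 2 * y) * P y / 2 + 2 * y * (1 - y) * P' y with hR
  set E := fun y : ℝ => Real.sqrt (w y) * (P y ^ 2 + R y ^ 2 / D y) with hE
  have hwpos : ∀ y, 0 < y → y ≤ 1 / 2 → 0 < w y := fun y h1 h2 => by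
    simp only [hw]; have : 0 < 1 - y := by linarith
    positivity
  have hDpos : ∀ y, 0 < y → y ≤ 1 / 2 → 0 < D y := fun y h1 h2 => by
    have := hwpos y h1 h2
    simp only [hD]; positivity
  have hder : ∀ y, 0 < y → y ≤ 1 / 2 →
      HasDerivAt E ((1 - 2 * y) * R y ^ 2 / (Real.sqrt (w y) * D y ^ 2)) y := by
    intro y h1 h2
    have w0 := hwpos y h1 h2
    have D0 := hDpos y h1 h2
    have dP : HasDerivAt P (P' y) y := (LR N).hasDerivAt y
    have dP' : HasDerivAt P' (P'' y) y := (derivative (LR N)).hasDerivAt y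
    have dx : HasDerivAt (fun y : ℝ => y) 1 y := hasDerivAt_id' y
    have dw : HasDerivAt w (4 - 8 * y) y := by
      convert! (dx.const_mul 4).mul (dx.const_sub 1) using 1
      ring
    have dD : HasDerivAt D (m * (4 - 8 * y)) y := (dw.const_mul m).add_const _
    have ode := LR_ode N y
    have dR : HasDerivAt R (-(2 * m + 1 / 2) * P y + (1 - 2 * y) * P' y / 2) y := by
      convert! ((((dx.const_mul 2).const_sub 1).mul dP).div_const 2).add
        (((dx.const_mul 2).mul (dx.const_sub 1)).mul dP') using 1
      simp only [hm, hP, hP', hP''] at *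
      simp only [Pi.mul_apply]
      linear_combination (-2) * ode
    have ds := dw.sqrt w0.ne'
    have dE := ds.mul ((dP.pow 2).add ((dR.pow 2).div dD D0.ne'))
    convert! dE using 1
    have hs : Real.sqrt (w y) ^ 2 = w y := Real.sq_sqrt w0.le
    have s0 : 0 < Real.sqrt (w y) := Real.sqrt_pos.2 w0
    have hDe : D y = m * w y + 1 / 4 := rfl
    have hPe : w y * P' y = 2 * R y - (1 - 2 * y) * P y := by simp only [hR, hw]; ring
    have hwe : w y = 1 - (1 - 2 * y) ^ 2 := by simp only [hw]; ring
    simp only [Pi.pow_apply, Pi.add_apply, Pi.div_apply, Nat.cast_ofNat, Nat.add_one_sub_one, pow_one]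
    clear dE ds
    generalize Real.sqrt (w y) = s at *
    generalize D y = d at *
    generalize R y = r at *
    generalize P y = p at *
    generalize P' y = p' at *
    generalize w y = W at *
    field_simp
    linear_combination (-2 * (2 * d ^ 2 * p * p' + (r * d * (-(p * (2 ^ 2 * m + 1)) + (1 - 2 * y) * p')
      - (4 - y * 8) * m * r ^ 2))) * hs - 2 * (2 * d ^ 2 * p + r * d * (1 - 2 * y)) * hPe
      + (-8 * r * d * p - 8 * (1 - 2 * y) * r ^ 2) * hDe + 2 * r * d * p * hwe
  have hmono : MonotoneOn E (Set.Icc y (1 / 2)) := by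
    apply monotoneOn_of_deriv_nonneg (convex_Icc _ _)
    · intro z hz
      exact (hder z (by linarith [hz.1]) hz.2).continuousAt.continuousWithinAt
    · intro z hz
      rw [interior_Icc] at hz
      exact (hder z (by linarith [hz.1]) hz.2.le).differentiableAt.differentiableWithinAt
    · intro z hz
      rw [interior_Icc] at hz
      rw [(hder z (by linarith [hz.1]) hz.2.le).deriv]
      have : 0 ≤ 1 - 2 * z := by linarith [hz.2]
      positivity
  have h1 := hmono ⟨le_refl y, hy2⟩ ⟨hy2, le_refl _⟩ hy2
  have h2 : E (1 / 2) = P (1 / 2) ^ 2 := by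
    have : R (1 / 2) = 0 := by
      simp only [hR, hP', LR_deriv_half N hN]; norm_num
    simp only [hE, this, hw]; norm_num
  rw [h2] at h1
  refine le_trans ?_ h1
  have w0 := hwpos y hy hy2
  have D0 := hDpos y hy hy2
  calc Real.sqrt y * P y ^ 2 ≤ Real.sqrt (w y) * P y ^ 2 := by
        gcongr
        simp only [hw]; nlinarith
    _ ≤ E y := by
        simp only [hE]
        gcongr
        have : 0 ≤ R y ^ 2 / D y := by positivity
        linarith

end LegAux

namespace LegAux

lemma series_deriv (a : ℕ → ℝ) (ha : ∀ k, |a k| ≤ 1 / (k.factorial : ℝ)) (v : ℝ) :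
    HasDerivAt (fun z => ∑' k, a k * z ^ k) (∑' k : ℕ, ((k : ℝ) + 1) * a (k + 1) * v ^ k) v := by
  set R : ℝ := |v| + 1 with hR
  have hR0 : 0 ≤ R := by positivity
  have hu : Summable (fun k : ℕ => (1 / (k.factorial : ℝ)) * (k * R ^ (k - 1))) := by
    rw [← summable_nat_add_iff 1]
    refine (Real.summable_pow_div_factorial R).congr fun k => ?_
    rw [Nat.factorial_succ]
    push_cast
    have : (k.factorial : ℝ) ≠ 0 := by positivity
    have : (k : ℝ) + 1 ≠ 0 := by positivity
    field_simp
  have hb : ∀ n : ℕ, ∀ y ∈ Metric.ball (0 : ℝ) R,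
      ‖a n * (n * y ^ (n - 1))‖ ≤ (1 / (n.factorial : ℝ)) * (n * R ^ (n - 1)) := by
    intro n y hy
    rw [mem_ball_zero_iff, Real.norm_eq_abs] at hy
    rw [norm_mul, norm_mul, norm_pow, Real.norm_eq_abs, Real.norm_eq_abs, Real.norm_eq_abs,
      Nat.abs_cast]
    have := ha n
    gcongr
  have hv : v ∈ Metric.ball (0 : ℝ) R := by
    rw [mem_ball_zero_iff, Real.norm_eq_abs]; linarith
  have h := hasDerivAt_tsum_of_isPreconnected (g := fun k z => a k * z ^ k)
    (g' := fun k z => a k * (k * z ^ (k - 1))) (y₀ := 0) (y := v) hu Metric.isOpen_ball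
    (convex_ball (0 : ℝ) R).isPreconnected
    (fun n y _ => (hasDerivAt_pow n y).const_mul (a n)) hb
    (by simp; positivity)
    (by
      refine summable_of_ne_finset_zero (s := {0}) ?_
      intro b hb
      have : b ≠ 0 := by simpa using hb
      simp [this]) hv
  convert! h using 1
  rw [Summable.tsum_eq_zero_add (Summable.of_norm_bounded hu (fun n => hb n v hv))]
  simp
  congr 1
  funext k
  ring

lemma series_summable (a : ℕ → ℝ) (ha : ∀ k, |a k| ≤ 1 / (k.factorial : ℝ)) (v : ℝ) :
    Summable (fun k => a k * v ^ k) := by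
  refine Summable.of_norm_bounded (Real.summable_pow_div_factorial |v|) fun k => ?_
  rw [norm_mul, norm_pow, Real.norm_eq_abs, Real.norm_eq_abs]
  have := ha k
  calc |a k| * |v| ^ k ≤ 1 / (k.factorial : ℝ) * |v| ^ k := by gcongr
    _ = _ := by ring

noncomputable def fc (k : ℕ) : ℝ := (-1) ^ k / (k.factorial : ℝ) ^ 2
noncomputable def gc (k : ℕ) : ℝ := (-1) ^ k / ((k.factorial : ℝ) * ((k + 1).factorial : ℝ))
noncomputable def hc (k : ℕ) : ℝ := -(-1) ^ k * k / (k.factorial : ℝ) ^ 2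

lemma fact1 (k : ℕ) : (1 : ℝ) ≤ (k.factorial : ℝ) := by
  exact_mod_cast Nat.one_le_iff_ne_zero.2 (Nat.factorial_ne_zero k)

lemma fc_bd (k : ℕ) : |fc k| ≤ 1 / (k.factorial : ℝ) := by
  have := fact1 k
  simp only [fc, abs_div, abs_pow, abs_neg, abs_one, one_pow, Nat.abs_cast]
  apply one_div_le_one_div_of_le (by positivity)
  nlinarith

lemma hc_bd (k : ℕ) : |hc k| ≤ 1 / (k.factorial : ℝ) := by
  have := fact1 k
  have h2 : (k : ℝ) ≤ (k.factorial : ℝ) := by exact_mod_cast Nat.self_le_factorial k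
  simp only [hc, abs_div, abs_mul, abs_pow, abs_neg, abs_one, one_pow, Nat.abs_cast]
  rw [div_le_div_iff₀ (by positivity) (by positivity)]
  nlinarith

noncomputable def F (v : ℝ) : ℝ := ∑' k, fc k * v ^ k
noncomputable def G (v : ℝ) : ℝ := ∑' k, gc k * v ^ k
noncomputable def H (v : ℝ) : ℝ := v * G v

lemma F_deriv (v : ℝ) : HasDerivAt F (-G v) v := by
  have := series_deriv fc fc_bd v
  convert! this using 1
  rw [G, ← tsum_neg]
  congr 1
  funext k
  simp only [fc, gc, Nat.factorial_succ, pow_succ]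
  push_cast
  have : (k.factorial : ℝ) ≠ 0 := by positivity
  have : (k : ℝ) + 1 ≠ 0 := by positivity
  field_simp

lemma H_eq (v : ℝ) : H v = ∑' k, hc k * v ^ k := by
  rw [Summable.tsum_eq_zero_add (series_summable hc hc_bd v), H, G, ← tsum_mul_left]
  simp only [hc]
  simp
  congr 1
  funext k
  simp only [gc, Nat.factorial_succ, pow_succ]
  push_cast
  have : (k.factorial : ℝ) ≠ 0 := by positivity
  have : (k : ℝ) + 1 ≠ 0 := by positivity
  field_simp

lemma H_deriv (v : ℝ) : HasDerivAt H (F v) v := by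
  have := series_deriv hc hc_bd v
  rw [show H = fun z => ∑' k, hc k * z ^ k from funext H_eq]
  convert! this using 1
  rw [F]
  congr 1
  funext k
  simp only [fc, hc, Nat.factorial_succ, pow_succ]
  push_cast
  have : (k.factorial : ℝ) ≠ 0 := by positivity
  have : (k : ℝ) + 1 ≠ 0 := by positivity
  field_simp

lemma F_cont : Continuous F := continuous_iff_continuousAt.2 fun v => (F_deriv v).continuousAt
lemma H_cont : Continuous H := continuous_iff_continuousAt.2 fun v => (H_deriv v).continuousAt

lemma F_deriv' (v : ℝ) (hv : 0 < v) : HasDerivAt F (-(H v / v)) v := by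
  convert! F_deriv v using 2
  rw [H]; field_simp

lemma F_zero : F 0 = 1 := by
  rw [F, tsum_eq_single 0]
  · simp [fc]
  · intro b hb; simp [hb]

lemma J0_eq (t : ℝ) : besselJ0 t = F (t ^ 2 / 4) := by
  rw [besselJ0, F]
  congr 1
  funext k
  rw [fc, show t ^ 2 / 4 = (t / 2) ^ 2 by ring, ← pow_mul]
  ring

lemma J1_eq (t : ℝ) : besselJ1 t = t / 2 * G (t ^ 2 / 4) := by
  rw [besselJ1, G, ← tsum_mul_left]
  congr 1
  funext k
  rw [gc, show t ^ 2 / 4 = (t / 2) ^ 2 by ring, ← pow_mul]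
  ring

lemma F_ge (v : ℝ) (h0 : 0 ≤ v) (h1 : v ≤ 1) : 1 - v ≤ F v := by
  have hs := (series_summable fc fc_bd v).hasSum.tendsto_sum_nat
  have hs' : Tendsto (fun n => ∑ i ∈ Finset.range n, (-1 : ℝ) ^ i * (v ^ i / (i.factorial : ℝ) ^ 2))
      atTop (nhds (F v)) := by
    refine hs.congr fun n => Finset.sum_congr rfl fun i _ => ?_
    rw [fc]; ring
  have ha : Antitone (fun i : ℕ => v ^ i / (i.factorial : ℝ) ^ 2) := by
    apply antitone_nat_of_succ_le
    intro n
    have h2 : v ^ (n + 1) ≤ v ^ n := pow_le_pow_of_le_one h0 h1 (Nat.le_succ n)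
    have h3 : (n.factorial : ℝ) ≤ ((n + 1).factorial : ℝ) := by
      exact_mod_cast Nat.factorial_le (Nat.le_succ n)
    gcongr
  have := ha.alternating_series_le_tendsto hs' 1
  simp [Finset.sum_range_succ] at this
  linarith

lemma FH_ne (v : ℝ) (hv : 0 < v) (hH : H v = 0) : F v ≠ 0 := by
  intro hF
  have hm : Monotone (fun v => H v ^ 2 + v * F v ^ 2) := by
    have hd : ∀ v, HasDerivAt (fun v => H v ^ 2 + v * F v ^ 2) (F v ^ 2) v := by
      intro v
      convert! ((H_deriv v).pow 2).add ((hasDerivAt_id' v).mul ((F_deriv v).pow 2)) using 1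
      simp [H]; ring
    apply monotone_of_deriv_nonneg (fun v => (hd v).differentiableAt)
    intro v
    rw [(hd v).deriv]; positivity
  have h1 : 0 < min v (1 / 2) := by positivity
  have h2 := hm (min_le_left v (1 / 2))
  have h3 := F_ge (min v (1 / 2)) h1.le ((min_le_right _ _).trans (by norm_num))
  have h4 : 0 < F (min v (1 / 2)) := by linarith [min_le_right v (1 / 2)]
  simp only [hF, hH] at h2
  have : 0 < min v (1 / 2) * F (min v (1 / 2)) ^ 2 := by positivity
  nlinarith [sq_nonneg (H (min v (1 / 2)))]

lemma sturm (a e : ℝ) (ha : 0 < a) (h : ∀ t ∈ Set.Icc a (a + Real.pi), 0 < e * F (t ^ 2 / 4)) :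
    False := by
  set f := fun t : ℝ => e * F (t ^ 2 / 4) with hf
  set g := fun t : ℝ => e * (H (t ^ 2 / 4) * 2 / t) with hg
  have df : ∀ t, 0 < t → HasDerivAt f (-g t) t := by
    intro t ht
    have h1 : HasDerivAt (fun t : ℝ => t ^ 2 / 4) (t / 2) t := by
      convert! (hasDerivAt_pow 2 t).div_const 4 using 1
      simp; ring
    have h2 := (HasDerivAt.comp t (F_deriv' (t ^ 2 / 4) (by positivity)) h1).const_mul e
    convert! h2 using 1
    simp only [hg]; field_simp
    ring
  have dg : ∀ t, 0 < t → HasDerivAt g (f t - g t / t) t := by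
    intro t ht
    have h1 : HasDerivAt (fun t : ℝ => t ^ 2 / 4) (t / 2) t := by
      convert! (hasDerivAt_pow 2 t).div_const 4 using 1
      simp; ring
    have h2 := ((((HasDerivAt.comp t (H_deriv (t ^ 2 / 4)) h1).mul_const 2).div
      (hasDerivAt_id' t) ht.ne')).const_mul e
    convert! h2 using 1
    simp only [hg, hf, Function.comp]; field_simp
  set W := fun t : ℝ => Real.sqrt t * ((f t / (2 * t) - g t) * Real.sin (t - a) - f t * Real.cos (t - a)) with hW
  have dW : ∀ t, 0 < t → HasDerivAt W (-(Real.sqrt t * f t * Real.sin (t - a) / (4 * t ^ 2))) t := by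
    intro t ht
    have hs := Real.hasDerivAt_sqrt ht.ne'
    have hx : HasDerivAt (fun t : ℝ => t - a) 1 t := (hasDerivAt_id' t).sub_const a
    have h1 := ((df t ht).div ((hasDerivAt_id' t).const_mul 2) (by positivity)).sub (dg t ht)
    have h2 := hs.mul ((h1.mul hx.sin).sub ((df t ht).mul hx.cos))
    convert! h2 using 1
    have s0 : 0 < Real.sqrt t := Real.sqrt_pos.2 ht
    have hss : Real.sqrt t ^ 2 = t := Real.sq_sqrt ht.le
    simp only [Pi.sub_apply, Pi.mul_apply, Pi.div_apply]
    generalize Real.sqrt t = s at *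
    subst hss
    field_simp
    ring
  have hanti : StrictAntiOn W (Set.Icc a (a + Real.pi)) := by
    apply strictAntiOn_of_deriv_neg (convex_Icc _ _)
    · intro t ht
      exact (dW t (by linarith [ht.1])).continuousAt.continuousWithinAt
    · intro t ht
      rw [interior_Icc] at ht
      have ht0 : 0 < t := by linarith [ht.1]
      rw [(dW t ht0).deriv]
      have h1 : 0 < f t := h t ⟨ht.1.le, ht.2.le⟩
      have h2 : 0 < Real.sin (t - a) :=
        Real.sin_pos_of_pos_of_lt_pi (by linarith [ht.1]) (by linarith [ht.2])
      have : 0 < Real.sqrt t := Real.sqrt_pos.2 ht0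
      rw [neg_lt_zero]
      positivity
  have hp := Real.pi_pos
  have h1 := hanti ⟨le_refl a, by linarith⟩ ⟨by linarith, le_refl _⟩ (show a < a + Real.pi by linarith)
  have e1 : W a = -(Real.sqrt a * f a) := by simp [hW]
  have e2 : W (a + Real.pi) = Real.sqrt (a + Real.pi) * f (a + Real.pi) := by simp [hW]
  rw [e1, e2] at h1
  have f1 : 0 < f a := h a ⟨le_refl a, by linarith⟩
  have f2 : 0 < f (a + Real.pi) := h _ ⟨by linarith, le_refl _⟩
  have : 0 ≤ Real.sqrt a * f a := by positivity
  have : 0 ≤ Real.sqrt (a + Real.pi) * f (a + Real.pi) := by positivity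
  linarith

lemma spacing (α β e : ℝ) (hα : 0 ≤ α) (hβ : α < β) (h : ∀ v ∈ Set.Ioo α β, 0 < e * F v) :
    Real.sqrt β ≤ Real.sqrt α + Real.pi / 2 := by
  by_contra! hc
  set d := Real.sqrt β - Real.sqrt α - Real.pi / 2 with hd
  have hd0 : 0 < d := by linarith
  have sa := Real.sqrt_nonneg α
  have sb := Real.sqrt_nonneg β
  have hp := Real.pi_pos
  apply sturm (2 * Real.sqrt α + d) e (by linarith)
  intro t ht
  apply h
  have t0 : 0 < t := by linarith [ht.1]
  have h1 : α = Real.sqrt α ^ 2 := (Real.sq_sqrt hα).symm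
  have h2 : β = Real.sqrt β ^ 2 := (Real.sq_sqrt (by linarith)).symm
  constructor
  · nlinarith [ht.1]
  · nlinarith [ht.2]

end LegAux

namespace LegAux

lemma sgn_sq (k : ℕ) : ((-1 : ℝ) ^ k) * (-1) ^ k = 1 := by
  rw [← mul_pow]; simp

/-- sign propagation -/
lemma sign_H (e a b : ℝ) (hab : a < b) (ha : H a = 0) (hF : 0 < e * F a)
    (hne : ∀ v ∈ Set.Ioo a b, H v ≠ 0) : ∀ v ∈ Set.Ioo a b, 0 < e * H v := by
  have hd : HasDerivAt (fun v => e * H v) (e * F a) a := (H_deriv a).const_mul e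
  -- a point near a with positive value
  have h1 : ∀ᶠ z in nhdsWithin a (Set.Ioi a), 0 < e * F z :=
    ((continuous_const.mul F_cont).continuousAt.eventually (lt_mem_nhds hF)).filter_mono
      nhdsWithin_le_nhds
  obtain ⟨c, hc, hcs⟩ := (mem_nhdsGT_iff_exists_Ioo_subset' hab).1 h1
  have hc' : a < c := hc
  have key : ∀ z, a < z → z < c → 0 < e * H z := by
    intro z hz hzc
    have hm : StrictMonoOn (fun v => e * H v) (Set.Icc a z) := by
      apply strictMonoOn_of_deriv_pos (convex_Icc _ _)
      · exact (continuous_const.mul H_cont).continuousOn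
      · intro t ht
        rw [interior_Icc] at ht
        rw [((H_deriv t).const_mul e).deriv]
        exact hcs ⟨ht.1, ht.2.trans hzc⟩
    have := hm ⟨le_refl a, hz.le⟩ ⟨hz.le, le_refl z⟩ hz
    simpa [ha] using this
  have e0 : e ≠ 0 := by rintro rfl; simp at hF
  intro v hv
  by_contra! hneg
  set z := (a + min v c) / 2 with hz
  have m1 : a < min v c := lt_min hv.1 hc'
  have hz1 : a < z := by linarith
  have hzv : z < v := by linarith [min_le_left v c]
  have hzc : z < c := by linarith [min_le_right v c]
  have hpos := key z hz1 hzc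
  have : (0 : ℝ) ∈ Set.Icc (e * H v) (e * H z) := ⟨hneg, hpos.le⟩
  obtain ⟨t, ht, ht0⟩ := intermediate_value_Icc' hzv.le
    (f := fun v => e * H v) (continuous_const.mul H_cont).continuousOn this
  have : H t = 0 := by
    rcases mul_eq_zero.1 ht0 with h | h
    · exact absurd h e0
    · exact h
  exact hne t ⟨by linarith [ht.1], by linarith [ht.2, hv.2]⟩ this

lemma sign_F_next (e a b : ℝ) (ha : 0 ≤ a) (hab : a < b) (hb : H b = 0)
    (hH : ∀ v ∈ Set.Ioo a b, 0 < e * H v) : 0 < -e * F b := by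
  have hbF := FH_ne b (by linarith) hb
  have e0 : e ≠ 0 := by
    rintro rfl
    have := hH ((a + b) / 2) ⟨by linarith, by linarith⟩
    simp at this
  by_contra! hneg
  have hF : 0 < e * F b := lt_of_le_of_ne (by linarith) (mul_ne_zero e0 hbF).symm
  have h1 : ∀ᶠ z in nhdsWithin b (Set.Iio b), 0 < e * F z :=
    ((continuous_const.mul F_cont).continuousAt.eventually (lt_mem_nhds hF)).filter_mono
      nhdsWithin_le_nhds
  obtain ⟨c, hc, hcs⟩ := (mem_nhdsLT_iff_exists_Ioo_subset' hab).1 h1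
  have hc' : c < b := hc
  set z := (b + max a c) / 2 with hz
  have m1 : max a c < b := max_lt hab hc'
  have hza : a < z := by linarith [le_max_left a c]
  have hzc : c < z := by linarith [le_max_right a c]
  have hzb : z < b := by linarith
  have hm : StrictMonoOn (fun v => e * H v) (Set.Icc z b) := by
    apply strictMonoOn_of_deriv_pos (convex_Icc _ _)
    · exact (continuous_const.mul H_cont).continuousOn
    · intro t ht
      rw [interior_Icc] at ht
      rw [((H_deriv t).const_mul e).deriv]
      exact hcs ⟨hzc.trans ht.1, ht.2⟩
  have := hm ⟨le_refl z, hzb.le⟩ ⟨hzb.le, le_refl b⟩ hzb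
  simp only [hb, mul_zero] at this
  linarith [hH z ⟨hza, hzb⟩]

lemma F_anti (e a b : ℝ) (ha : 0 ≤ a) (hH : ∀ v ∈ Set.Ioo a b, 0 < e * H v) :
    StrictAntiOn (fun v => e * F v) (Set.Icc a b) := by
  apply strictAntiOn_of_deriv_neg (convex_Icc _ _)
  · exact (continuous_const.mul F_cont).continuousOn
  · intro t ht
    rw [interior_Icc] at ht
    have t0 : 0 < t := by linarith [ht.1]
    rw [((F_deriv' t t0).const_mul e).deriv]
    have := hH t ht
    have : 0 < e * H t / t := by positivity
    rw [mul_neg, neg_lt_zero, ← mul_div_assoc]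
    exact this

lemma zeros (c : ℕ → ℝ) (c0 : c 0 = 0) (hc : StrictMono c) (hz : ∀ k, H (c k) = 0)
    (hall : ∀ v, 0 < v → H v = 0 → ∃ k, v = c k) :
    ∃ ζ : ℕ → ℝ, ζ 0 = 0 ∧ StrictMono ζ ∧ Tendsto ζ atTop atTop ∧
      (∀ k, ∀ v ∈ Set.Ioo (ζ k) (ζ (k + 1)), 0 < (-1) ^ k * F v) ∧
      (∀ k, ∀ v ∈ Set.Icc (ζ k) (ζ (k + 1)), (-1) ^ k * F v ≤ (-1) ^ k * F (c k)) := by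
  have cnn : ∀ k, 0 ≤ c k := fun k => c0 ▸ hc.monotone (Nat.zero_le k)
  have hne : ∀ k, ∀ v ∈ Set.Ioo (c k) (c (k + 1)), H v ≠ 0 := by
    intro k v hv h0
    obtain ⟨m, rfl⟩ := hall v (lt_of_le_of_lt (cnn k) hv.1) h0
    have h1 := hc.lt_iff_lt.1 hv.1
    have h2 := hc.lt_iff_lt.1 hv.2
    omega
  have hQ : ∀ k, 0 < (-1 : ℝ) ^ k * F (c k) := by
    intro k
    induction k with
    | zero => simp [c0, F_zero]
    | succ k ih =>
      have h1 := sign_H _ _ _ (hc (Nat.lt_succ_self k)) (hz k) ih (hne k)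
      have := sign_F_next _ _ _ (cnn k) (hc (Nat.lt_succ_self k)) (hz (k + 1)) h1
      rw [pow_succ]
      linarith
  have hA : ∀ k, StrictAntiOn (fun v => (-1 : ℝ) ^ k * F v) (Set.Icc (c k) (c (k + 1))) := fun k =>
    F_anti _ _ _ (cnn k) (sign_H _ _ _ (hc (Nat.lt_succ_self k)) (hz k) (hQ k) (hne k))
  have hex : ∀ k, ∃ x, x ∈ Set.Ioo (c k) (c (k + 1)) ∧ F x = 0 := by
    intro k
    have h2 := hQ (k + 1)
    rw [pow_succ] at h2
    have : (0 : ℝ) ∈ Set.Ioo ((-1 : ℝ) ^ k * F (c (k + 1))) ((-1 : ℝ) ^ k * F (c k)) :=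
      ⟨by linarith, hQ k⟩
    obtain ⟨x, hx, hx0⟩ := intermediate_value_Ioo' (hc (Nat.lt_succ_self k)).le
      (f := fun v => (-1 : ℝ) ^ k * F v) (continuous_const.mul F_cont).continuousOn this
    refine ⟨x, hx, ?_⟩
    rcases mul_eq_zero.1 hx0 with h | h
    · simp at h
    · exact h
  choose x hx hx0 using hex
  have ctop : Tendsto c atTop atTop := by
    rcases tendsto_atTop_of_monotone hc.monotone with h | ⟨l, hl⟩
    · exact h
    · exfalso
      have hle := hc.monotone.ge_of_tendsto hl
      have h1 : Tendsto (fun k => H (c k)) atTop (nhds (H l)) := (H_cont.tendsto l).comp hl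
      simp only [hz] at h1
      have h2 : H l = 0 := tendsto_nhds_unique h1 tendsto_const_nhds |>.symm ▸ rfl
      have l0 : 0 < l := by
        have := hle 1
        have := hc (Nat.zero_lt_one)
        linarith
      obtain ⟨m, rfl⟩ := hall l l0 h2
      exact absurd (hle (m + 1)) (not_le.2 (hc (Nat.lt_succ_self m)))
  refine ⟨fun k => Nat.casesOn k 0 x, rfl, ?_, ?_, ?_, ?_⟩
  · apply strictMono_nat_of_lt_succ
    intro k
    rcases k with _ | k
    · show 0 < x 0
      have := (hx 0).1; rw [c0] at this; exact this
    · show x k < x (k + 1)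
      exact (hx k).2.trans (hx (k + 1)).1
  · rw [← tendsto_add_atTop_iff_nat 1]
    exact tendsto_atTop_mono (fun k => (hx k).1.le) ctop
  · -- sign
    have hr : ∀ k, ∀ v, c k ≤ v → v < x k → 0 < (-1) ^ k * F v := by
      intro k v h1 h2
      have := hA k ⟨h1, h2.le.trans (hx k).2.le⟩ ⟨(hx k).1.le, (hx k).2.le⟩ h2
      simpa [hx0] using this
    intro k v hv
    rcases k with _ | k
    · exact hr 0 v (by rw [c0]; exact hv.1.le) hv.2
    · have hv1 : x k < v := hv.1
      have hv2 : v < x (k + 1) := hv.2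
      rcases le_total (c (k + 1)) v with h | h
      · exact hr (k + 1) v h hv2
      · have := hA k ⟨(hx k).1.le, (hx k).2.le⟩ ⟨(hx k).1.le.trans hv1.le, h⟩ hv1
        simp only [hx0, mul_zero] at this
        rw [pow_succ]; linarith
  · have hr : ∀ k, ∀ v, c k ≤ v → v ≤ x k → (-1) ^ k * F v ≤ (-1) ^ k * F (c k) := by
      intro k v h1 h2
      exact (hA k).antitoneOn ⟨le_refl _, (hc (Nat.lt_succ_self k)).le⟩
        ⟨h1, h2.trans (hx k).2.le⟩ h1
    intro k v hv
    rcases k with _ | k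
    · exact hr 0 v (by rw [c0]; exact hv.1) hv.2
    · have hv1 : x k ≤ v := hv.1
      have hv2 : v ≤ x (k + 1) := hv.2
      rcases le_total (c (k + 1)) v with h | h
      · exact hr (k + 1) v h hv2
      · have := (hA k).antitoneOn ⟨(hx k).1.le.trans hv1, h⟩ ⟨(hc (Nat.lt_succ_self k)).le, le_refl _⟩ h
        rw [pow_succ]; linarith

lemma zeta_gap (ζ : ℕ → ℝ) (h0 : ζ 0 = 0) (hm : StrictMono ζ)
    (hs : ∀ k, ∀ v ∈ Set.Ioo (ζ k) (ζ (k + 1)), 0 < (-1) ^ k * F v) (i : ℕ) :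
    ζ (2 * i + 2) - ζ (2 * i + 1) ≤ 3 * Real.pi ^ 2 / 2 * (i + 1) := by
  have nn : ∀ k, 0 ≤ ζ k := fun k => h0 ▸ hm.monotone (Nat.zero_le k)
  have hsp : ∀ k, Real.sqrt (ζ (k + 1)) ≤ Real.sqrt (ζ k) + Real.pi / 2 := fun k =>
    spacing _ _ _ (nn k) (hm (Nat.lt_succ_self k)) (hs k)
  have hk : ∀ k : ℕ, Real.sqrt (ζ k) ≤ k * (Real.pi / 2) := by
    intro k
    induction k with
    | zero => simp [h0]
    | succ k ih => have := hsp k; push_cast; linarith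
  have a1 := hk (2 * i + 1)
  have a2 := hk (2 * i + 2)
  have a3 := hsp (2 * i + 1)
  have a4 := Real.sqrt_nonneg (ζ (2 * i + 1))
  have a5 := Real.sqrt_nonneg (ζ (2 * i + 2))
  have e1 := Real.sq_sqrt (nn (2 * i + 1))
  have e2 := Real.sq_sqrt (nn (2 * i + 2))
  have hp := Real.pi_pos
  rw [show 2 * i + 1 + 1 = 2 * i + 2 by ring] at a3
  rw [← e1, ← e2]
  push_cast at a1 a2
  generalize Real.sqrt (ζ (2 * i + 1)) = s at *
  generalize Real.sqrt (ζ (2 * i + 2)) = r at *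
  have : r ^ 2 - s ^ 2 = (r - s) * (r + s) := by ring
  rw [this]
  have b1 : (r - s) * (r + s) ≤ (Real.pi / 2) * (r + s) := by
    apply mul_le_mul_of_nonneg_right <;> linarith
  have i0 : (0 : ℝ) ≤ i := Nat.cast_nonneg i
  nlinarith [mul_nonneg i0 (sq_nonneg Real.pi), sq_nonneg Real.pi]

end LegAux

namespace LegAux
open Polynomial

lemma LR_coeff_bd (N k : ℕ) (hN : 1 ≤ N) :
    |(LR N).coeff k| ≤ (2 * (N : ℝ) ^ 2) ^ k / (k.factorial : ℝ) ^ 2 := by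
  have hN' : (1 : ℝ) ≤ N := by exact_mod_cast hN
  induction k with
  | zero => simp [LR_coeff]
  | succ k ih =>
    have hr := LR_rec N k
    rcases le_or_gt (k + 1) N with h | h
    · have hk : ((k : ℝ) + 1) ≤ N := by exact_mod_cast h
      have k0 : (0 : ℝ) ≤ k := Nat.cast_nonneg k
      have e1 : |(LR N).coeff (k + 1)| = |(k * (k + 1) - N * (N + 1) : ℝ)| / ((k : ℝ) + 1) ^ 2 * |(LR N).coeff k| := by
        have h2 := congrArg abs hr
        rw [abs_mul, abs_mul, abs_of_nonneg (show (0 : ℝ) ≤ ((k : ℝ) + 1) ^ 2 by positivity)] at h2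
        field_simp
        linarith
      have e2 : |(k * (k + 1) - N * (N + 1) : ℝ)| ≤ 2 * (N : ℝ) ^ 2 := by
        rw [abs_le]; constructor <;> nlinarith
      rw [e1, Nat.factorial_succ]
      push_cast
      calc |(k * (k + 1) - N * (N + 1) : ℝ)| / ((k : ℝ) + 1) ^ 2 * |(LR N).coeff k|
          ≤ 2 * (N : ℝ) ^ 2 / ((k : ℝ) + 1) ^ 2 * ((2 * (N : ℝ) ^ 2) ^ k / (k.factorial : ℝ) ^ 2) := by
            gcongr
        _ = _ := by
            rw [pow_succ]
            have : (k.factorial : ℝ) ≠ 0 := by positivity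
            field_simp
            ring
    · rw [LR_coeff, Nat.choose_eq_zero_of_lt h]
      simp
      positivity

/-- rescaled evaluation -/
noncomputable def A (n : ℕ) (v : ℝ) : ℝ := (LR (4 * n)).eval (v / ((4 * n : ℕ) : ℝ) ^ 2)

lemma A_eq (n : ℕ) (v : ℝ) :
    A n v = ∑' k, (LR (4 * n)).coeff k * (v / ((4 * n : ℕ) : ℝ) ^ 2) ^ k := by
  rw [A, eval_eq_sum_range, tsum_eq_sum]
  intro b hb
  have : (LR (4 * n)).natDegree < b := by simpa [Nat.lt_succ_iff] using hb
  rw [coeff_eq_zero_of_natDegree_lt this, zero_mul]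

lemma A_term_bd (n : ℕ) (hn : 1 ≤ n) (v : ℝ) (k : ℕ) :
    ‖(LR (4 * n)).coeff k * (v / ((4 * n : ℕ) : ℝ) ^ 2) ^ k‖ ≤ (2 * |v|) ^ k / (k.factorial : ℝ) := by
  have h := LR_coeff_bd (4 * n) k (by omega)
  have hN : (0 : ℝ) < ((4 * n : ℕ) : ℝ) := by exact_mod_cast (by omega : 0 < 4 * n)
  generalize ((4 * n : ℕ) : ℝ) = M at *
  rw [norm_mul, norm_pow, Real.norm_eq_abs, Real.norm_eq_abs, abs_div,
    abs_of_pos (show 0 < M ^ 2 by positivity)]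
  have hf := fact1 k
  calc |(LR (4 * n)).coeff k| * (|v| / M ^ 2) ^ k
      ≤ ((2 * M ^ 2) ^ k / (k.factorial : ℝ) ^ 2) * (|v| / M ^ 2) ^ k := by gcongr
    _ = (2 * |v|) ^ k / (k.factorial : ℝ) ^ 2 := by
        rw [mul_pow, div_pow, mul_pow]; field_simp
    _ ≤ _ := by
        gcongr
        nlinarith

lemma A_bd (n : ℕ) (hn : 1 ≤ n) (v : ℝ) (h0 : 0 ≤ v) (h1 : v ≤ 1) : |A n v| ≤ Real.exp 2 := by
  rw [A_eq, ← Real.norm_eq_abs]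
  have hs := Real.summable_pow_div_factorial (2 : ℝ)
  have : Real.exp 2 = ∑' k : ℕ, (2 : ℝ) ^ k / (k.factorial : ℝ) := by
    rw [Real.exp_eq_exp_ℝ, NormedSpace.exp_eq_tsum_div]
  rw [this]
  apply tsum_of_norm_bounded hs.hasSum
  intro k
  refine (A_term_bd n hn v k).trans ?_
  gcongr
  rw [abs_of_nonneg h0]; linarith

lemma coeff_tendsto (k : ℕ) : Tendsto (fun n : ℕ => (LR (4 * n)).coeff k / (((4 * n : ℕ) : ℝ) ^ 2) ^ k)
    atTop (nhds (fc k)) := by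
  induction k with
  | zero => simp [LR_coeff, fc]
  | succ k ih =>
    have hinv : Tendsto (fun n : ℕ => (((4 * n : ℕ) : ℝ))⁻¹) atTop (nhds 0) := by
      refine tendsto_inv_atTop_zero.comp ?_
      refine tendsto_natCast_atTop_atTop.comp ?_
      exact tendsto_id.const_mul_atTop' (by norm_num)
    have h1 : Tendsto (fun n : ℕ => ((k * (k + 1) : ℝ) * (((4 * n : ℕ) : ℝ))⁻¹ ^ 2
        - (1 + (((4 * n : ℕ) : ℝ))⁻¹)) / ((k : ℝ) + 1) ^ 2) atTop (nhds (-1 / ((k : ℝ) + 1) ^ 2)) := by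
      have := (((hinv.pow 2).const_mul (k * (k + 1) : ℝ)).sub (hinv.const_add 1)).div_const (((k : ℝ) + 1) ^ 2)
      simpa using this
    have h2 := h1.mul ih
    have e : -1 / ((k : ℝ) + 1) ^ 2 * fc k = fc (k + 1) := by
      rw [fc, fc, Nat.factorial_succ, pow_succ]
      push_cast
      have : (k.factorial : ℝ) ≠ 0 := by positivity
      field_simp
      ring
    rw [e] at h2
    refine h2.congr' ?_
    filter_upwards [eventually_ge_atTop 1] with n hn
    have hr := LR_rec (4 * n) k
    have hN : (0 : ℝ) < ((4 * n : ℕ) : ℝ) := by exact_mod_cast (by omega : 0 < 4 * n)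
    generalize ((4 * n : ℕ) : ℝ) = M at *
    have hr' : (LR (4 * n)).coeff (k + 1) = (k * (k + 1) - M * (M + 1)) * (LR (4 * n)).coeff k / ((k : ℝ) + 1) ^ 2 := by
      field_simp
      linarith
    rw [hr', pow_succ]
    field_simp
    ring

lemma A_tendsto (v : ℝ) : Tendsto (fun n => A n v) atTop (nhds (F v)) := by
  simp only [A_eq, F]
  refine tendsto_tsum_of_dominated_convergence (Real.summable_pow_div_factorial (2 * |v|)) ?_ ?_
  · intro k
    have := (coeff_tendsto k).mul_const (v ^ k)
    refine this.congr fun n => ?_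
    rw [div_pow]; ring
  · filter_upwards [eventually_ge_atTop 1] with n hn k
    exact A_term_bd n hn v k

lemma A_decay (n : ℕ) (hn : 1 ≤ n) (v : ℝ) (h0 : 0 < v) (h1 : v ≤ ((4 * n : ℕ) : ℝ) ^ 2 / 2) :
    A n v ^ 2 ≤ v ^ (-(1 / 2) : ℝ) := by
  have hN : (0 : ℝ) < ((4 * n : ℕ) : ℝ) := by exact_mod_cast (by omega : 0 < 4 * n)
  have hh := LR_half (2 * n)
  rw [show 2 * (2 * n) = 4 * n by ring] at hh
  have he := energy (4 * n) ⟨2 * n, by ring⟩ (v / ((4 * n : ℕ) : ℝ) ^ 2) (by positivity) (by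
    rw [div_le_iff₀ (by positivity)]; linarith)
  have hle : (1 : ℝ) / (2 * ((2 * n : ℕ) : ℝ) + 1) ≤ 1 / ((4 * n : ℕ) : ℝ) := by
    apply one_div_le_one_div_of_le hN
    push_cast; linarith
  have h3 := (he.trans hh).trans hle
  rw [Real.sqrt_div h0.le, Real.sqrt_sq hN.le, div_mul_eq_mul_div,
    div_le_div_iff_of_pos_right hN] at h3
  rw [Real.rpow_neg h0.le, ← Real.sqrt_eq_rpow]
  have s0 := Real.sqrt_pos.2 h0
  rw [← one_div, le_div_iff₀ s0, mul_comm]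
  exact h3

lemma A_cont (n : ℕ) : Continuous (A n) := by
  unfold A
  fun_prop

noncomputable def bd (p v : ℝ) : ℝ := if v ≤ 1 then Real.exp 2 ^ p else v ^ (-(p / 4))

lemma bd_int (p : ℝ) (hp : 4 < p) : IntegrableOn (bd p) (Set.Ioi 0) := by
  rw [← Set.Ioc_union_Ioi_eq_Ioi (zero_le_one' ℝ)]
  apply IntegrableOn.union
  · refine IntegrableOn.congr_fun (f := fun _ => Real.exp 2 ^ p) (by simp) ?_ measurableSet_Ioc
    intro x hx
    simp [bd, hx.2]
  · refine (integrableOn_Ioi_rpow_of_lt (a := -(p / 4)) (by linarith) zero_lt_one).congr_fun ?_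
      measurableSet_Ioi
    intro x hx
    simp only [bd]
    rw [if_neg (not_le.2 hx)]

lemma A_bd_p (p : ℝ) (hp : 4 < p) (n : ℕ) (hn : 1 ≤ n) (v : ℝ) (h0 : 0 < v)
    (h1 : v ≤ ((4 * n : ℕ) : ℝ) ^ 2 / 2) : |A n v| ^ p ≤ bd p v := by
  unfold bd
  split_ifs with h
  · exact Real.rpow_le_rpow (abs_nonneg _) (A_bd n hn v h0.le h) (by linarith)
  · have := A_decay n hn v h0 h1
    have e1 : |A n v| ^ p = (A n v ^ 2) ^ (p / 2) := by
      rw [← sq_abs, ← Real.rpow_natCast, ← Real.rpow_mul (abs_nonneg _)]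
      congr 1; push_cast; ring
    rw [e1]
    refine (Real.rpow_le_rpow (by positivity) this (by linarith)).trans ?_
    rw [← Real.rpow_mul h0.le]
    apply le_of_eq
    congr 1; ring

lemma scale_ev (v : ℝ) : ∀ᶠ n : ℕ in atTop, v ≤ ((4 * n : ℕ) : ℝ) ^ 2 / 2 := by
  obtain ⟨m, hm⟩ := exists_nat_ge v
  filter_upwards [eventually_ge_atTop m, eventually_ge_atTop 1] with n hn h1
  have : (m : ℝ) ≤ n := by exact_mod_cast hn
  have : (1 : ℝ) ≤ n := by exact_mod_cast h1
  push_cast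
  nlinarith

lemma F_bd (p : ℝ) (hp : 4 < p) (v : ℝ) (h0 : 0 < v) : |F v| ^ p ≤ bd p v := by
  have h1 : Tendsto (fun n => |A n v| ^ p) atTop (nhds (|F v| ^ p)) :=
    ((A_tendsto v).abs).rpow_const (Or.inr (by linarith))
  refine le_of_tendsto h1 ?_
  filter_upwards [scale_ev v, eventually_ge_atTop 1] with n hn h2
  exact A_bd_p p hp n h2 v h0 hn

lemma phiF_int (p : ℝ) (hp : 4 < p) (φ : ℝ → ℝ) (hc : Continuous φ) (hb : ∀ x, |φ x| ≤ |x| ^ p) :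
    IntegrableOn (fun v => φ (F v)) (Set.Ioi 0) := by
  refine Integrable.mono' (bd_int p hp) (hc.comp F_cont).aestronglyMeasurable ?_
  rw [ae_restrict_iff' measurableSet_Ioi]
  exact Eventually.of_forall fun v hv => (hb _).trans (F_bd p hp v hv)

lemma main_lim (p : ℝ) (hp : 4 < p) (φ : ℝ → ℝ) (hc : Continuous φ) (hb : ∀ x, |φ x| ≤ |x| ^ p) :
    Tendsto (fun n : ℕ => ((4 * n : ℕ) : ℝ) ^ 2 / 2 * ∫ x in (0:ℝ)..1, φ (legP (4 * n) x)) atTop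
      (nhds (∫ v in Set.Ioi 0, φ (F v))) := by
  have key : Tendsto (fun n : ℕ => ∫ v in Set.Ioi 0,
      (Set.Iic (((4 * n : ℕ) : ℝ) ^ 2 / 2)).indicator (fun v => φ (A n v)) v) atTop
      (nhds (∫ v in Set.Ioi 0, φ (F v))) := by
    refine tendsto_integral_filter_of_dominated_convergence (bd p) ?_ ?_ (bd_int p hp) ?_
    · exact Eventually.of_forall fun n =>
        ((hc.comp (A_cont n)).aestronglyMeasurable).indicator measurableSet_Iic
    · filter_upwards [eventually_ge_atTop 1] with n hn
      rw [ae_restrict_iff' measurableSet_Ioi]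
      refine Eventually.of_forall fun v hv => ?_
      have hv0 : 0 < v := hv
      by_cases h : v ≤ ((4 * n : ℕ) : ℝ) ^ 2 / 2
      · rw [Set.indicator_of_mem (by exact h)]
        exact (hb _).trans (A_bd_p p hp n hn v hv h)
      · rw [Set.indicator_of_notMem (by exact h), norm_zero]
        unfold bd
        split_ifs <;> positivity
    · refine Eventually.of_forall fun v => ?_
      refine ((hc.tendsto (F v)).comp (A_tendsto v)).congr' ?_
      filter_upwards [scale_ev v] with n hn
      rw [Set.indicator_of_mem (by exact hn)]
      rfl
  refine key.congr' ?_
  filter_upwards [eventually_ge_atTop 1] with n hn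
  have hN : (0 : ℝ) < ((4 * n : ℕ) : ℝ) := by exact_mod_cast (by omega : 0 < 4 * n)
  have hA : ∀ v, A n v = legP (4 * n) (1 - (2 / ((4 * n : ℕ) : ℝ) ^ 2) * v) := by
    intro v
    rw [A, ← legP_eq]
    congr 1; ring
  rw [setIntegral_indicator measurableSet_Iic, Set.Ioi_inter_Iic]
  simp only [hA]
  generalize ((4 * n : ℕ) : ℝ) = M at *
  rw [← intervalIntegral.integral_of_le (by positivity),
    intervalIntegral.integral_comp_sub_mul (fun x => φ (legP (4 * n) x)) (by positivity)]
  rw [smul_eq_mul]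
  have e1 : 1 - 2 / M ^ 2 * (M ^ 2 / 2) = 0 := by field_simp; norm_num
  have e2 : 1 - 2 / M ^ 2 * 0 = 1 := by ring
  rw [e1, e2]
  congr 1
  field_simp

end LegAux

namespace LegAux

lemma phi_cont (p : ℝ) (hp : 4 < p) : Continuous (fun x : ℝ => (max x 0) ^ p) :=
  (continuous_id.max continuous_const).rpow_const fun _ => Or.inr (by linarith)

lemma phin_cont (p : ℝ) (hp : 4 < p) : Continuous (fun x : ℝ => (max (-x) 0) ^ p) :=
  (continuous_neg.max continuous_const).rpow_const fun _ => Or.inr (by linarith)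

lemma phi_bd (p : ℝ) (hp : 4 < p) (x : ℝ) : |(max x 0) ^ p| ≤ |x| ^ p := by
  rw [abs_of_nonneg (by positivity)]
  exact Real.rpow_le_rpow (le_max_right _ _) (max_le (le_abs_self x) (abs_nonneg x)) (by linarith)

lemma phin_bd (p : ℝ) (hp : 4 < p) (x : ℝ) : |(max (-x) 0) ^ p| ≤ |x| ^ p := by
  have := phi_bd p hp (-x)
  rwa [abs_neg] at this

lemma pos_lower (p : ℝ) (hp : 4 < p) : 1 / (p + 1) ≤ ∫ v in Set.Ioi 0, (max (F v) 0) ^ p := by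
  have hi := phiF_int p hp _ (phi_cont p hp) (phi_bd p hp)
  have e : ∫ v in (0 : ℝ)..1, (1 - v) ^ p = 1 / (p + 1) := by
    rw [intervalIntegral.integral_comp_sub_left (fun x => x ^ p) 1, integral_rpow (Or.inl (by linarith))]
    simp
    rw [Real.zero_rpow (by linarith)]
    simp
  rw [← e]
  calc ∫ v in (0 : ℝ)..1, (1 - v) ^ p ≤ ∫ v in (0 : ℝ)..1, (max (F v) 0) ^ p := by
        apply intervalIntegral.integral_mono_on zero_le_one
        · apply Continuous.intervalIntegrable
          exact (continuous_const.sub continuous_id).rpow_const fun _ => Or.inr (by linarith)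
        · exact ((phi_cont p hp).comp F_cont).intervalIntegrable _ _
        · intro x hx
          exact Real.rpow_le_rpow (by linarith [hx.2])
            ((F_ge x hx.1 hx.2).trans (le_max_left _ _)) (by linarith)
    _ = ∫ v in Set.Ioc 0 1, (max (F v) 0) ^ p := intervalIntegral.integral_of_le zero_le_one
    _ ≤ _ := by
        apply setIntegral_mono_set hi
        · exact Eventually.of_forall fun v => by dsimp; positivity
        · exact Eventually.of_forall fun v hv => hv.1

lemma neg_pos (p : ℝ) (hp : 4 < p) (ζ : ℕ → ℝ) (z0 : ζ 0 = 0) (zm : StrictMono ζ)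
    (zs : ∀ k, ∀ v ∈ Set.Ioo (ζ k) (ζ (k + 1)), 0 < (-1) ^ k * F v) :
    0 < ∫ v in Set.Ioi 0, (max (-F v) 0) ^ p := by
  have hi := phiF_int p hp _ (phin_cont p hp) (phin_bd p hp)
  have h1 : ζ 1 < ζ 2 := zm (by norm_num)
  have h0 : 0 < ζ 1 := z0 ▸ zm (by norm_num)
  have hpos : 0 < ∫ v in ζ 1..ζ 2, (max (-F v) 0) ^ p := by
    apply intervalIntegral.intervalIntegral_pos_of_pos_on
    · exact ((phin_cont p hp).comp F_cont).intervalIntegrable _ _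
    · intro x hx
      have := zs 1 x hx
      apply Real.rpow_pos_of_pos
      apply lt_max_of_lt_left
      linarith
    · exact h1
  refine hpos.trans_le ?_
  rw [intervalIntegral.integral_of_le h1.le]
  apply setIntegral_mono_set hi
  · exact Eventually.of_forall fun v => by dsimp; positivity
  · exact Eventually.of_forall fun v hv => h0.trans hv.1

lemma neg_upper (p : ℝ) (hp : 4 < p) (c ζ : ℕ → ℝ) (z0 : ζ 0 = 0) (zm : StrictMono ζ)
    (ztop : Tendsto ζ atTop atTop)
    (zs : ∀ k, ∀ v ∈ Set.Ioo (ζ k) (ζ (k + 1)), 0 < (-1) ^ k * F v)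
    (zM : ∀ k, ∀ v ∈ Set.Icc (ζ k) (ζ (k + 1)), (-1) ^ k * F v ≤ (-1) ^ k * F (c k))
    (hS : Summable (fun i : ℕ => ((i : ℝ) + 1) * |F (c (2 * i + 1))| ^ p)) :
    ∫ v in Set.Ioi 0, (max (-F v) 0) ^ p ≤
      3 * Real.pi ^ 2 / 2 * ∑' i : ℕ, ((i : ℝ) + 1) * |F (c (2 * i + 1))| ^ p := by
  have hi := phiF_int p hp _ (phin_cont p hp) (phin_bd p hp)
  have hint : ∀ a b, IntervalIntegrable (fun v => (max (-F v) 0) ^ p) volume a b := fun a b =>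
    ((phin_cont p hp).comp F_cont).intervalIntegrable _ _
  have zlt : ∀ k, ζ k < ζ (k + 1) := fun k => zm (Nat.lt_succ_self k)
  have even0 : ∀ n, ∫ v in ζ (2 * n)..ζ (2 * n + 1), (max (-F v) 0) ^ p = 0 := by
    intro n
    have hle : ∫ v in ζ (2 * n)..ζ (2 * n + 1), (max (-F v) 0) ^ p
        ≤ ∫ v in ζ (2 * n)..ζ (2 * n + 1), (0 : ℝ) := by
      apply intervalIntegral.integral_mono_on_of_le_Ioo (zlt _).le (hint _ _) (by simp)
      intro v hv
      have h1 := zs (2 * n) v hv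
      rw [pow_mul] at h1
      simp at h1
      rw [max_eq_right (by linarith), Real.zero_rpow (by linarith)]
    have hge : 0 ≤ ∫ v in ζ (2 * n)..ζ (2 * n + 1), (max (-F v) 0) ^ p :=
      intervalIntegral.integral_nonneg (zlt _).le fun v _ => by positivity
    simp at hle
    linarith
  have odd1 : ∀ n : ℕ, ∫ v in ζ (2 * n + 1)..ζ (2 * n + 2), (max (-F v) 0) ^ p
      ≤ 3 * Real.pi ^ 2 / 2 * (((n : ℝ) + 1) * |F (c (2 * n + 1))| ^ p) := by
    intro n
    have hg := zeta_gap ζ z0 zm zs n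
    calc ∫ v in ζ (2 * n + 1)..ζ (2 * n + 2), (max (-F v) 0) ^ p
        ≤ ∫ v in ζ (2 * n + 1)..ζ (2 * n + 2), |F (c (2 * n + 1))| ^ p := by
          apply intervalIntegral.integral_mono_on (zlt (2 * n + 1)).le (hint _ _) (by simp)
          intro v hv
          have h1 := zM (2 * n + 1) v hv
          rw [pow_succ, pow_mul] at h1
          simp at h1
          apply Real.rpow_le_rpow (le_max_right _ _) _ (by linarith)
          apply max_le _ (abs_nonneg _)
          linarith [neg_abs_le (F (c (2 * n + 1)))]
      _ = (ζ (2 * n + 2) - ζ (2 * n + 1)) * |F (c (2 * n + 1))| ^ p := by simp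
      _ ≤ (3 * Real.pi ^ 2 / 2 * (n + 1)) * |F (c (2 * n + 1))| ^ p := by gcongr
      _ = _ := by ring
  have part : ∀ n : ℕ, ∫ v in (0 : ℝ)..ζ (2 * n), (max (-F v) 0) ^ p ≤
      3 * Real.pi ^ 2 / 2 * ∑ i ∈ Finset.range n, ((i : ℝ) + 1) * |F (c (2 * i + 1))| ^ p := by
    intro n
    induction n with
    | zero => simp [z0]
    | succ n ih =>
      rw [show 2 * (n + 1) = 2 * n + 2 by ring, Finset.sum_range_succ, mul_add (3 * Real.pi ^ 2 / 2),
        ← intervalIntegral.integral_add_adjacent_intervals (hint 0 (ζ (2 * n))) (hint _ _),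
        ← intervalIntegral.integral_add_adjacent_intervals (hint (ζ (2 * n)) (ζ (2 * n + 1))) (hint _ _),
        even0, zero_add]
      exact add_le_add ih (odd1 n)
  have ht : Tendsto (fun n => ζ (2 * n)) atTop atTop :=
    ztop.comp (tendsto_id.const_mul_atTop' (by norm_num))
  have hl := intervalIntegral_tendsto_integral_Ioi 0 hi ht
  refine le_of_tendsto' hl fun n => (part n).trans ?_
  have hp2 : 0 ≤ 3 * Real.pi ^ 2 / 2 := by positivity
  apply mul_le_mul_of_nonneg_left _ hp2
  exact hS.sum_le_tsum _ fun i _ => by positivity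

end LegAux

/-- For $p > 4$, the liminf of the ratio of the $p$-th power integrals of the positive
and negative parts of $P_{4n}$ is at least
$(1/(p+1))·(2/(3π²))·(Σ_{i≥1} i |J_0(j_{2i-1})|^p)^{-1}$, where $j_k$ is the $k$-th
smallest positive zero of $J_1$. -/
theorem liminf_ratio_ge (p : ℝ) (hp : 4 < p)
    (j : ℕ → ℝ)
    (hjpos : ∀ i, 1 ≤ i → 0 < j i)
    (hjzero : ∀ i, 1 ≤ i → besselJ1 (j i) = 0)
    (hjmono : ∀ i k, 1 ≤ i → i < k → j i < j k)
    (hjall : ∀ x : ℝ, 0 < x → besselJ1 x = 0 → ∃ i, 1 ≤ i ∧ x = j i) :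
    (1 / (p + 1)) * (2 / (3 * Real.pi ^ 2)) *
        (∑' i : ℕ, ((i : ℝ) + 1) * |besselJ0 (j (2 * i + 1))| ^ p)⁻¹ ≤
      Filter.liminf (fun n : ℕ =>
        (∫ x in (0:ℝ)..1, (legPpos (4 * n) x) ^ p) /
        (∫ x in (0:ℝ)..1, (legPneg (4 * n) x) ^ p)) Filter.atTop := by
  classical
  set c : ℕ → ℝ := fun k => if k = 0 then 0 else (j k) ^ 2 / 4 with hcdef
  have c0 : c 0 = 0 := by simp [hcdef]
  have cs : ∀ k, 1 ≤ k → c k = (j k) ^ 2 / 4 := by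
    intro k hk
    have : k ≠ 0 := by omega
    simp [hcdef, this]
  have hcm : StrictMono c := by
    intro a b hab
    rw [cs b (by omega)]
    rcases Nat.eq_zero_or_pos a with rfl | ha
    · rw [c0]
      have := hjpos b (by omega)
      positivity
    · rw [cs a ha]
      have h1 := hjpos a ha
      have h2 := hjmono a b ha hab
      nlinarith
  have hz : ∀ k, LegAux.H (c k) = 0 := by
    intro k
    rcases Nat.eq_zero_or_pos k with rfl | hk
    · rw [c0]; simp [LegAux.H]
    · have h1 := hjzero k hk
      have h0 := hjpos k hk
      rw [LegAux.J1_eq] at h1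
      have h2 : LegAux.G (j k ^ 2 / 4) = 0 := by
        rcases mul_eq_zero.1 h1 with h | h
        · linarith
        · exact h
      rw [cs k hk, LegAux.H, h2, mul_zero]
  have hall : ∀ v, 0 < v → LegAux.H v = 0 → ∃ k, v = c k := by
    intro v hv h0
    have hs : Real.sqrt v ^ 2 = v := Real.sq_sqrt hv.le
    have hG : LegAux.G v = 0 := by
      rcases mul_eq_zero.1 h0 with h | h
      · linarith
      · exact h
    have h1 : besselJ1 (2 * Real.sqrt v) = 0 := by
      rw [LegAux.J1_eq, show (2 * Real.sqrt v) ^ 2 / 4 = v by rw [mul_pow, hs]; ring, hG, mul_zero]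
    obtain ⟨i, hi, hie⟩ := hjall _ (by have := Real.sqrt_pos.2 hv; linarith) h1
    refine ⟨i, ?_⟩
    rw [cs i hi, ← hie, mul_pow, hs]; ring
  have hJ : ∀ i : ℕ, besselJ0 (j (2 * i + 1)) = LegAux.F (c (2 * i + 1)) := by
    intro i
    rw [LegAux.J0_eq, cs _ (by omega)]
  simp only [hJ]
  obtain ⟨ζ, z0, zm, ztop, zs, zM⟩ := LegAux.zeros c c0 hcm hz hall
  have hpos := LegAux.pos_lower p hp
  have hneg := LegAux.neg_pos p hp ζ z0 zm zs
  have l1 := LegAux.main_lim p hp (fun x => (max x 0) ^ p) (LegAux.phi_cont p hp) (LegAux.phi_bd p hp)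
  have l2 := LegAux.main_lim p hp (fun x => (max (-x) 0) ^ p) (LegAux.phin_cont p hp) (LegAux.phin_bd p hp)
  have l3 := l1.div l2 hneg.ne'
  have l4 : Tendsto (fun n : ℕ =>
        (∫ x in (0:ℝ)..1, (legPpos (4 * n) x) ^ p) /
        (∫ x in (0:ℝ)..1, (legPneg (4 * n) x) ^ p)) Filter.atTop
        (nhds ((∫ v in Set.Ioi 0, (max (LegAux.F v) 0) ^ p) /
          ∫ v in Set.Ioi 0, (max (-LegAux.F v) 0) ^ p)) := by
    refine l3.congr' ?_
    filter_upwards [eventually_ge_atTop 1] with n hn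
    have hN : (0 : ℝ) < ((4 * n : ℕ) : ℝ) := by exact_mod_cast (by omega : 0 < 4 * n)
    simp only [Pi.div_apply]
    rw [mul_div_mul_left _ _ (by positivity)]
    rfl
  rw [l4.liminf_eq]
  by_cases hS : Summable (fun i : ℕ => ((i : ℝ) + 1) * |LegAux.F (c (2 * i + 1))| ^ p)
  · have hup := LegAux.neg_upper p hp c ζ z0 zm ztop zs zM hS
    generalize (∑' i : ℕ, ((i : ℝ) + 1) * |LegAux.F (c (2 * i + 1))| ^ p) = S at *
    have hpi := Real.pi_pos
    have S0 : 0 < S := by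
      by_contra! h
      have : 3 * Real.pi ^ 2 / 2 * S ≤ 0 := mul_nonpos_of_nonneg_of_nonpos (by positivity) h
      linarith
    have p1 : 0 < p + 1 := by linarith
    calc 1 / (p + 1) * (2 / (3 * Real.pi ^ 2)) * S⁻¹ = (1 / (p + 1)) / (3 * Real.pi ^ 2 / 2 * S) := by
          field_simp
      _ ≤ _ := by gcongr
  · rw [tsum_eq_zero_of_not_summable hS]
    simp only [inv_zero, mul_zero]
    have : 0 < 1 / (p + 1) := by
      have : 0 < p + 1 := by linarith
      positivity
    exact div_nonneg (by linarith) hneg.le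
end
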